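/- arXiv:1502.07955 — 4 statements merged into one kernel-verified Lean document; each statement's English description precedes it below -/
import Mathlib

section
/- Let k > 1 and let F : ℝ → ℝ be continuously differentiable. Suppose V ∈ C²((0,∞)) is a positive solution of -V'' - (k/t)V' = F(V) on (0,∞) having Morse index one. Then the weighted eigenvalue problem -w''(t) - (k/t)w'(t) = F'(V(t))·w(t) + (λ/t²)·w(t) on (0,∞) admits at most one negative eigenvalue with eigenfunction in E: there do not exist real numbers λ₁ ≠ λ₂ with λ₁ < 0 and λ₂ < 0 together with nontrivial functions w₁, w₂ ∈ E ∩ C²((0,∞)) such that -w_j'' - (k/t)w_j' = F'(V)·w_j + (λ_j/t²)·w_j on (0,∞) for j = 1, 2. -/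
open MeasureTheory Filter Set Topology

/-- Membership in the space `E`: a `C¹` function on `(0,∞)` with
`∫₀^∞ t^k ((w')² + w²) dt < ∞`. -/
def memE (k : ℝ) (w : ℝ → ℝ) : Prop :=
  ContDiffOn ℝ 1 w (Ioi 0) ∧
  IntegrableOn (fun t => t ^ k * ((deriv w t) ^ 2 + (w t) ^ 2)) (Ioi 0)

/-- The Rayleigh quotient
`R(w) = (∫₀^∞ t^k ((w')² − A·w²) dt) / (∫₀^∞ t^k w² dt)`. -/
noncomputable def Ray (k : ℝ) (A : ℝ → ℝ) (w : ℝ → ℝ) : ℝ :=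
  (∫ t in Ioi (0:ℝ), t ^ k * ((deriv w t) ^ 2 - A t * (w t) ^ 2)) /
    ∫ t in Ioi (0:ℝ), t ^ k * (w t) ^ 2

/-- Morse index one: the infimum of the Rayleigh quotient over nonzero elements of `E`
is negative, while on every two-dimensional subspace of `E` the maximum of the
Rayleigh quotient over nonzero elements is nonnegative. -/
def MorseIndexOne (k : ℝ) (A : ℝ → ℝ) : Prop :=
  (∃ w, memE k w ∧ (∃ t ∈ Ioi (0:ℝ), w t ≠ 0) ∧ Ray k A w < 0) ∧
  ∀ w₁ w₂ : ℝ → ℝ, memE k w₁ → memE k w₂ →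
    (∀ c₁ c₂ : ℝ, (∀ t ∈ Ioi (0:ℝ), c₁ * w₁ t + c₂ * w₂ t = 0) → c₁ = 0 ∧ c₂ = 0) →
    ∃ c₁ c₂ : ℝ, ¬(c₁ = 0 ∧ c₂ = 0) ∧
      0 ≤ Ray k A (fun t => c₁ * w₁ t + c₂ * w₂ t)

theorem integrableOn_Ioi_of_eq_zero_off_Icc {f : ℝ → ℝ} {a b : ℝ} (ha : 0 < a)
    (hf : ContinuousOn f (Ioi 0)) (h0 : ∀ t > (0:ℝ), t ∉ Icc a b → f t = 0) :
    IntegrableOn f (Ioi 0) := by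
  have hsub : Icc a b ⊆ Ioi 0 := fun t ht => lt_of_lt_of_le ha ht.1
  refine IntegrableOn.of_forall_sdiff_eq_zero (s := Icc a b)
    ((hf.mono hsub).integrableOn_compact isCompact_Icc) measurableSet_Ioi ?_
  rintro t ⟨ht, ht'⟩
  exact h0 t ht ht'

theorem setIntegral_Ioi_eq_zero_of_hasDerivAt {G g : ℝ → ℝ} {a b : ℝ} (ha : 0 < a)
    (hG : ∀ t > (0:ℝ), HasDerivAt G (g t) t) (hg : ContinuousOn g (Ioi 0))
    (hG0 : ∀ t > (0:ℝ), t ∉ Icc a b → G t = 0) (hg0 : ∀ t > (0:ℝ), t ∉ Icc a b → g t = 0) :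
    ∫ t in Ioi (0:ℝ), g t = 0 := by
  have hle : a / 2 ≤ max a b + 1 := by
    have := le_max_left a b
    linarith
  have h1 : ∫ t in Ioi (0:ℝ), g t = ∫ t in Ioc (a / 2) (max a b + 1), g t := by
    refine (setIntegral_eq_of_subset_of_forall_sdiff_eq_zero measurableSet_Ioi ?_ ?_)
    · intro t ht
      have := ht.1
      simp only [mem_Ioi]
      linarith
    · rintro t ⟨ht, ht'⟩
      refine hg0 t ht fun hab => ht' ⟨by linarith [hab.1], ?_⟩
      linarith [hab.2, le_max_right a b]
  have hpos : ∀ t ∈ uIcc (a / 2) (max a b + 1), 0 < t := by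
    intro t ht
    rw [uIcc_of_le hle] at ht
    linarith [ht.1]
  rw [h1, ← intervalIntegral.integral_of_le hle,
    intervalIntegral.integral_eq_sub_of_hasDerivAt (fun t ht => hG t (hpos t ht))
      ((hg.mono hpos).intervalIntegrable),
    hG0 _ (by linarith [le_max_left a b]) (fun h => by linarith [h.2, le_max_right a b]),
    hG0 _ (by linarith) (fun h => by linarith [h.1]), sub_zero]

theorem setIntegral_Ioc_pos_of_continuousOn {f : ℝ → ℝ} (hf : ContinuousOn f (Ioi 0))
    (h0 : ∀ t > (0:ℝ), 0 ≤ f t) {t₀ : ℝ} (ht₀ : 0 < t₀) (hpos : 0 < f t₀) :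
    0 < ∫ t in Ioc (t₀ / 2) (2 * t₀), f t := by
  rw [← intervalIntegral.integral_of_le (by linarith)]
  refine intervalIntegral.integral_pos (by linarith)
    (hf.mono fun t ht => by have := ht.1; simp only [mem_Ioi]; linarith)
    (fun t ht => h0 t (by linarith [ht.1])) ⟨t₀, ⟨by linarith, by linarith⟩, hpos⟩

/-- `φ` is a cutoff function on `(0,∞)` with derivative `ψ`, supported in `[a, b]`, equal to `1`
where `s |log t| ≤ 1`, and with `|ψ t| ≤ C s / t`. -/
structure IsLogCutoff (C s : ℝ) (φ ψ : ℝ → ℝ) (a b : ℝ) : Prop where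
  left_pos : 0 < a
  contDiffOn : ContDiffOn ℝ 1 φ (Ioi 0)
  hasDerivAt : ∀ t > (0:ℝ), HasDerivAt φ (ψ t) t
  continuousOn_deriv : ContinuousOn ψ (Ioi 0)
  eq_zero : ∀ t > (0:ℝ), t ∉ Icc a b → φ t = 0
  deriv_eq_zero : ∀ t > (0:ℝ), t ∉ Icc a b → ψ t = 0
  abs_deriv_le : ∀ t > (0:ℝ), |ψ t| ≤ C * s / t
  nonneg : ∀ t, 0 ≤ φ t
  le_one : ∀ t, φ t ≤ 1
  eq_one : ∀ t > (0:ℝ), s * |Real.log t| ≤ 1 → φ t = 1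

theorem exists_isLogCutoff :
    ∃ C : ℝ, 0 ≤ C ∧ ∀ s > (0:ℝ), ∃ φ ψ a b, IsLogCutoff C s φ ψ a b := by
  let χ : ContDiffBump (0:ℝ) := ⟨1, 2, one_pos, one_lt_two⟩
  have hχ : ContDiff ℝ 1 χ := χ.contDiff
  have hχ' : Continuous (deriv χ) := hχ.continuous_deriv le_rfl
  obtain ⟨C, hC⟩ := χ.hasCompactSupport.deriv.exists_bound_of_continuous hχ'
  have hC0 : 0 ≤ C := (norm_nonneg _).trans (hC 0)
  have hts : ∀ x, 2 < |x| → x ∉ tsupport χ := by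
    intro x hx hx'
    rw [χ.tsupport_eq, mem_closedBall_zero_iff, Real.norm_eq_abs] at hx'
    exact absurd hx' (not_le.mpr hx)
  have hlarge : ∀ s > (0:ℝ), ∀ t > (0:ℝ), t ∉ Icc (Real.exp (-(2 / s))) (Real.exp (2 / s)) →
      2 < |s * Real.log t| := by
    intro s hs t ht hn
    rw [abs_mul, abs_of_pos hs]
    by_contra! h
    have h2 : |Real.log t| ≤ 2 / s := by rw [le_div_iff₀ hs]; linarith
    rw [abs_le] at h2
    exact hn ⟨(Real.le_log_iff_exp_le ht).1 h2.1, (Real.log_le_iff_le_exp ht).1 h2.2⟩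
  have hlog : ContinuousOn Real.log (Ioi 0) :=
    Real.continuousOn_log.mono fun _ ht => ne_of_gt ht
  refine ⟨C, hC0, fun s hs => ⟨fun t => χ (s * Real.log t),
    fun t => deriv χ (s * Real.log t) * (s * t⁻¹), Real.exp (-(2 / s)), Real.exp (2 / s),
    Real.exp_pos _, ?_, ?_, ?_, ?_, ?_, ?_, fun _ => χ.nonneg, fun _ => χ.le_one, ?_⟩⟩
  · refine hχ.comp_contDiffOn (contDiffOn_const.mul ?_)
    exact Real.contDiffOn_log.mono fun t ht => ne_of_gt ht
  · intro t ht
    exact ((hχ.differentiable one_ne_zero) _).hasDerivAt.comp t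
      ((Real.hasDerivAt_log ht.ne').const_mul s)
  · refine (hχ'.comp_continuousOn (continuousOn_const.mul hlog)).mul
      (continuousOn_const.mul (continuousOn_id.inv₀ fun _ ht => ne_of_gt ht))
  · intro t ht hn
    exact image_eq_zero_of_notMem_tsupport (hts _ (hlarge s hs t ht hn))
  · intro t ht hn
    have : deriv χ (s * Real.log t) = 0 := by
      by_contra h
      exact hts _ (hlarge s hs t ht hn) (support_deriv_subset h)
    simp only [this, zero_mul]
  · intro t ht
    have h1 := hC (s * Real.log t)
    rw [Real.norm_eq_abs] at h1
    have h2 : 0 < s * t⁻¹ := by positivity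
    rw [abs_mul, abs_of_pos h2, div_eq_mul_inv, mul_assoc]
    exact mul_le_mul_of_nonneg_right h1 h2.le
  · intro t ht h
    refine χ.one_of_mem_closedBall ?_
    rw [mem_closedBall_zero_iff, Real.norm_eq_abs, abs_mul, abs_of_pos hs]
    exact h

theorem continuousOn_rpow_Ioi (k : ℝ) : ContinuousOn (fun t : ℝ => t ^ k) (Ioi 0) :=
  fun t ht => (Real.continuousAt_rpow_const t k (Or.inl (ne_of_gt ht))).continuousWithinAt

theorem continuousOn_rpow_div_sq (k : ℝ) :
    ContinuousOn (fun t : ℝ => t ^ k / t ^ 2) (Ioi 0) :=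
  (continuousOn_rpow_Ioi k).div (continuousOn_id.pow 2) fun _ ht => pow_ne_zero 2 (ne_of_gt ht)

theorem hasDerivAt_of_contDiffOn_Ioi {w : ℝ → ℝ} (hw : ContDiffOn ℝ 1 w (Ioi 0)) :
    ∀ t > (0:ℝ), HasDerivAt w (deriv w t) t := fun _ ht =>
  ((hw.differentiableOn one_ne_zero).differentiableAt (Ioi_mem_nhds ht)).hasDerivAt

theorem contDiffOn_deriv_Ioi {w : ℝ → ℝ} (hw : ContDiffOn ℝ 2 w (Ioi 0)) :
    ContDiffOn ℝ 1 (deriv w) (Ioi 0) :=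
  ((contDiffOn_succ_iff_deriv_of_isOpen isOpen_Ioi (n := 1)).1
    (by simpa [one_add_one_eq_two] using hw)).2.2

theorem continuousOn_deriv_Ioi {w : ℝ → ℝ} (hw : ContDiffOn ℝ 1 w (Ioi 0)) :
    ContinuousOn (deriv w) (Ioi 0) :=
  hw.continuousOn_deriv_of_isOpen isOpen_Ioi le_rfl

theorem hasDerivAt_rpow_div {k t : ℝ} (ht : 0 < t) :
    HasDerivAt (fun t : ℝ => t ^ k) (k * (t ^ k / t)) t := by
  have h := Real.hasDerivAt_rpow_const (x := t) (p := k) (Or.inl ht.ne')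
  rwa [Real.rpow_sub_one ht.ne'] at h

namespace memE

variable {k : ℝ} {w : ℝ → ℝ}

theorem integrableOn_rpow_mul_sq (hw : memE k w) :
    IntegrableOn (fun t => t ^ k * w t ^ 2) (Ioi 0) := by
  refine Integrable.mono' hw.2 (ContinuousOn.aestronglyMeasurable
    ((continuousOn_rpow_Ioi k).mul (hw.1.continuousOn.pow 2)) measurableSet_Ioi) ?_
  refine (ae_restrict_iff' measurableSet_Ioi).2 (.of_forall fun t ht => ?_)
  have hk := Real.rpow_nonneg (le_of_lt ht) k
  rw [Real.norm_eq_abs, abs_of_nonneg (by positivity)]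
  exact mul_le_mul_of_nonneg_left (by nlinarith [sq_nonneg (deriv w t)]) hk

theorem integrableOn_rpow_mul_deriv_sq (hw : memE k w) :
    IntegrableOn (fun t => t ^ k * deriv w t ^ 2) (Ioi 0) := by
  refine (hw.2.sub hw.integrableOn_rpow_mul_sq).congr (.of_forall fun t => ?_)
  simp only [Pi.sub_apply]
  ring

/-- Hardy's inequality at the origin, in qualitative form. -/
theorem integrableOn_rpow_div_sq_mul_sq (hk : 1 < k) (hw : memE k w) :
    IntegrableOn (fun t => t ^ k / t ^ 2 * w t ^ 2) (Ioi 0) := by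
  have hcont : ContinuousOn (fun t => t ^ k / t ^ 2 * w t ^ 2) (Ioi 0) :=
    (continuousOn_rpow_div_sq k).mul (hw.1.continuousOn.pow 2)
  have hk1 : 0 < k - 1 := by linarith
  have hcontd := continuousOn_deriv_Ioi hw.1
  rw [← Ioc_union_Ioi_eq_Ioi (zero_le_one (α := ℝ))]
  refine IntegrableOn.union ?_ ?_
  · set D := ∫ t in Ioi (0:ℝ), t ^ k * deriv w t ^ 2 with hD
    have hsub : ∀ ε > (0:ℝ), Icc ε 1 ⊆ Ioi 0 := fun ε hε t ht => lt_of_lt_of_le hε ht.1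
    have hbound : ∀ ε > (0:ℝ), ε ≤ 1 → ∫ t in ε..1, t ^ k / t ^ 2 * w t ^ 2 ≤
        2 * (w 1 ^ 2 / (k - 1) + 2 / (k - 1) ^ 2 * D) := by
      intro ε hε hε1
      have hu : ∀ t ∈ uIcc ε 1, 0 < t := by
        rw [uIcc_of_le hε1]
        exact hsub ε hε
      have hG : ∀ t ∈ uIcc ε 1, HasDerivAt (fun t => t ^ k / t * w t ^ 2 / (k - 1))
          (t ^ k / t ^ 2 * w t ^ 2 + 2 / (k - 1) * (t ^ k / t * (w t * deriv w t))) t := by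
        intro t ht
        have ht := hu t ht
        have := (((hasDerivAt_rpow_div (k := k) ht).div (hasDerivAt_id t) ht.ne').mul
          ((hasDerivAt_of_contDiffOn_Ioi hw.1 t ht).pow 2)).div_const (k - 1)
        refine this.congr_deriv ?_
        simp only [Pi.div_apply, Pi.pow_apply, id, Nat.cast_ofNat]
        field_simp
        ring
      have hc1 : ContinuousOn (fun t => 2 / (k - 1) * (t ^ k / t * (w t * deriv w t))) (Ioi 0) :=
        continuousOn_const.mul (((continuousOn_rpow_Ioi k).div continuousOn_id
          fun t ht => ne_of_gt ht).mul (hw.1.continuousOn.mul hcontd))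
      have hc2 : ContinuousOn (fun t => t ^ k * deriv w t ^ 2) (Ioi 0) :=
        (continuousOn_rpow_Ioi k).mul (hcontd.pow 2)
      have hFTC := intervalIntegral.integral_eq_sub_of_hasDerivAt hG
        (((hcont.add hc1).mono hu).intervalIntegrable)
      have hI := (hcont.mono hu).intervalIntegrable (μ := volume)
      have hI1 := (hc1.mono hu).intervalIntegrable (μ := volume)
      have hI2 := (hc2.mono hu).intervalIntegrable (μ := volume)
      rw [intervalIntegral.integral_add hI hI1] at hFTC
      have hmono : ∫ t in ε..1, -(2 / (k - 1) * (t ^ k / t * (w t * deriv w t))) ≤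
          ∫ t in ε..1, (1 / 2 * (t ^ k / t ^ 2 * w t ^ 2)
            + 2 / (k - 1) ^ 2 * (t ^ k * deriv w t ^ 2)) := by
        refine intervalIntegral.integral_mono_on hε1 hI1.neg
          ((hI.const_mul _).add (hI2.const_mul _)) fun t ht => ?_
        have ht := hsub ε hε ht
        have ht : 0 < t := ht
        have hkp := Real.rpow_pos_of_pos ht k
        have : (1 / 2 * (t ^ k / t ^ 2 * w t ^ 2) + 2 / (k - 1) ^ 2 * (t ^ k * deriv w t ^ 2))
            + 2 / (k - 1) * (t ^ k / t * (w t * deriv w t))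
            = t ^ k / 2 * (w t / t + 2 / (k - 1) * deriv w t) ^ 2 := by
          field_simp
          ring
        have h2 : 0 ≤ t ^ k / 2 * (w t / t + 2 / (k - 1) * deriv w t) ^ 2 := by positivity
        linarith
      rw [intervalIntegral.integral_neg, intervalIntegral.integral_add (hI.const_mul _)
        (hI2.const_mul _), intervalIntegral.integral_const_mul (1 / 2 : ℝ),
        intervalIntegral.integral_const_mul (2 / (k - 1) ^ 2)] at hmono
      have hDle : ∫ t in ε..1, t ^ k * deriv w t ^ 2 ≤ D := by
        rw [intervalIntegral.integral_of_le hε1]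
        refine setIntegral_mono_set hw.integrableOn_rpow_mul_deriv_sq ?_
          (LE.le.eventuallyLE fun t ht => lt_trans hε ht.1)
        refine (ae_restrict_iff' measurableSet_Ioi).2 (.of_forall fun t ht => ?_)
        exact mul_nonneg (Real.rpow_nonneg (le_of_lt ht) k) (sq_nonneg _)
      have hDle' := mul_le_mul_of_nonneg_left hDle (show 0 ≤ 2 / (k - 1) ^ 2 by positivity)
      have hb : 0 ≤ ε ^ k / ε * w ε ^ 2 / (k - 1) := by
        have := Real.rpow_nonneg hε.le k
        positivity
      simp only [Real.one_rpow, div_one, one_mul] at hFTC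
      linarith
    refine integrableOn_Ioc_of_intervalIntegral_norm_bounded_left
      (a := fun n : ℕ => 1 / ((n : ℝ) + 1))
      (I := 2 * (w 1 ^ 2 / (k - 1) + 2 / (k - 1) ^ 2 * D)) (l := atTop) ?_
      tendsto_one_div_add_atTop_nhds_zero_nat ?_
    · intro n
      have hn : (0:ℝ) < 1 / ((n : ℝ) + 1) := by positivity
      exact ((hcont.mono (hsub _ hn)).integrableOn_compact isCompact_Icc).mono_set Ioc_subset_Icc_self
    · refine .of_forall fun n => ?_
      have hn : (0:ℝ) < 1 / ((n : ℝ) + 1) := by positivity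
      have hn1 : 1 / ((n : ℝ) + 1) ≤ 1 := by
        rw [div_le_one (by positivity)]
        linarith [n.cast_nonneg (α := ℝ)]
      refine le_trans (le_of_eq ?_) (hbound _ hn hn1)
      rw [intervalIntegral.integral_of_le hn1]
      refine setIntegral_congr_fun measurableSet_Ioc fun t ht => ?_
      have ht : 0 < t := lt_trans hn ht.1
      have := Real.rpow_nonneg ht.le k
      simp only [Real.norm_eq_abs]
      rw [abs_of_nonneg (by positivity)]
  · have hsub : Ioi (1:ℝ) ⊆ Ioi 0 := Ioi_subset_Ioi zero_le_one
    refine Integrable.mono' (hw.integrableOn_rpow_mul_sq.mono_set hsub)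
      ((hcont.mono hsub).aestronglyMeasurable measurableSet_Ioi) ?_
    refine (ae_restrict_iff' measurableSet_Ioi).2 (.of_forall fun t ht => ?_)
    have ht : 1 < t := ht
    have hkp := Real.rpow_nonneg (show 0 ≤ t by linarith) k
    rw [Real.norm_eq_abs, abs_of_nonneg (by positivity)]
    refine mul_le_mul_of_nonneg_right (div_le_self hkp (by nlinarith)) (sq_nonneg _)

end memE

namespace IsLogCutoff

variable {C s a b : ℝ} {φ ψ : ℝ → ℝ}

theorem memE_mul {k : ℝ} {w : ℝ → ℝ} (h : IsLogCutoff C s φ ψ a b)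
    (hw : ContDiffOn ℝ 1 w (Ioi 0)) : memE k (fun t => φ t * w t) := by
  have hc : ContDiffOn ℝ 1 (fun t => φ t * w t) (Ioi 0) := h.contDiffOn.mul hw
  refine ⟨hc, integrableOn_Ioi_of_eq_zero_off_Icc (b := b) h.left_pos
    ((continuousOn_rpow_Ioi k).mul (((continuousOn_deriv_Ioi hc).pow 2).add
      (hc.continuousOn.pow 2))) fun t ht hn => ?_⟩
  have hd : deriv (fun t => φ t * w t) t = ψ t * w t + φ t * deriv w t :=
    ((h.hasDerivAt t ht).mul (hasDerivAt_of_contDiffOn_Ioi hw t ht)).deriv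
  simp only [hd, h.eq_zero t ht hn, h.deriv_eq_zero t ht hn]
  ring

/-- The energy of `φ w`, where `-w'' - (k/t) w' = A w + g / t²`. -/
theorem integral_energy_eq {k : ℝ} {A g w p q : ℝ → ℝ} (h : IsLogCutoff C s φ ψ a b)
    (hA : ContinuousOn A (Ioi 0)) (hg : ContinuousOn g (Ioi 0))
    (hw : ∀ t > (0:ℝ), HasDerivAt w (p t) t) (hp : ∀ t > (0:ℝ), HasDerivAt p (q t) t)
    (hode : ∀ t > (0:ℝ), -q t - k / t * p t = A t * w t + g t / t ^ 2) :
    IntegrableOn (fun t => t ^ k * ψ t ^ 2 * w t ^ 2 + φ t ^ 2 * (t ^ k / t ^ 2 * (g t * w t)))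
      (Ioi 0) ∧
    ∫ t in Ioi (0:ℝ), t ^ k * ((ψ t * w t + φ t * p t) ^ 2 - A t * (φ t * w t) ^ 2) =
      ∫ t in Ioi (0:ℝ),
        (t ^ k * ψ t ^ 2 * w t ^ 2 + φ t ^ 2 * (t ^ k / t ^ 2 * (g t * w t))) := by
  have hwc : ContinuousOn w (Ioi 0) := fun t ht => (hw t ht).continuousAt.continuousWithinAt
  have hpc : ContinuousOn p (Ioi 0) := fun t ht => (hp t ht).continuousAt.continuousWithinAt
  have hφ := h.contDiffOn.continuousOn
  have hψ := h.continuousOn_deriv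
  have hc1 : ContinuousOn (fun t => t ^ k * ((ψ t * w t + φ t * p t) ^ 2
      - A t * (φ t * w t) ^ 2)) (Ioi 0) :=
    (continuousOn_rpow_Ioi k).mul ((((hψ.mul hwc).add (hφ.mul hpc)).pow 2).sub
      (hA.mul ((hφ.mul hwc).pow 2)))
  have hc2 : ContinuousOn (fun t => t ^ k * ψ t ^ 2 * w t ^ 2
      + φ t ^ 2 * (t ^ k / t ^ 2 * (g t * w t))) (Ioi 0) :=
    (((continuousOn_rpow_Ioi k).mul (hψ.pow 2)).mul (hwc.pow 2)).add
      ((hφ.pow 2).mul ((continuousOn_rpow_div_sq k).mul (hg.mul hwc)))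
  have hi1 := integrableOn_Ioi_of_eq_zero_off_Icc (b := b) h.left_pos hc1 fun t ht hn => by
    simp only [h.eq_zero t ht hn, h.deriv_eq_zero t ht hn]
    ring
  have hi2 := integrableOn_Ioi_of_eq_zero_off_Icc (b := b) h.left_pos hc2 fun t ht hn => by
    simp only [h.eq_zero t ht hn, h.deriv_eq_zero t ht hn]
    ring
  refine ⟨hi2, sub_eq_zero.1 ?_⟩
  rw [← integral_sub hi1 hi2]
  refine setIntegral_Ioi_eq_zero_of_hasDerivAt (G := fun t => t ^ k * φ t ^ 2 * (w t * p t))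
    (b := b) h.left_pos (fun t ht => ?_) (hc1.sub hc2) (fun t ht hn => ?_) fun t ht hn => ?_
  · have hd := ((hasDerivAt_rpow_div (k := k) ht).mul ((h.hasDerivAt t ht).pow 2)).mul
      ((hw t ht).mul (hp t ht))
    refine hd.congr_deriv ?_
    have hq : q t = -(k / t * p t) - A t * w t - g t / t ^ 2 := by linarith [hode t ht]
    simp only [Pi.pow_apply, Pi.mul_apply, hq, Nat.cast_ofNat]
    have := ne_of_gt ht
    field_simp
    ring
  · simp only [h.eq_zero t ht hn]
    ring
  · simp only [h.eq_zero t ht hn, h.deriv_eq_zero t ht hn]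
    ring

/-- Eigenfunctions for distinct eigenvalues are almost orthogonal against a slowly varying
cutoff. -/
theorem abs_integral_mul_le {k l₁ l₂ : ℝ} {A w₁ w₂ : ℝ → ℝ} (h : IsLogCutoff C s φ ψ a b)
    (hC : 0 ≤ C) (hs : 0 < s) (hk : 1 < k) (hw₁ : memE k w₁) (hw₂ : memE k w₂)
    (hw₁' : ContDiffOn ℝ 2 w₁ (Ioi 0)) (hw₂' : ContDiffOn ℝ 2 w₂ (Ioi 0))
    (hode₁ : ∀ t > (0:ℝ), -(deriv (deriv w₁) t) - k / t * deriv w₁ t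
      = A t * w₁ t + l₁ / t ^ 2 * w₁ t)
    (hode₂ : ∀ t > (0:ℝ), -(deriv (deriv w₂) t) - k / t * deriv w₂ t
      = A t * w₂ t + l₂ / t ^ 2 * w₂ t) :
    |l₁ - l₂| * |∫ t in Ioi (0:ℝ), φ t ^ 2 * (t ^ k / t ^ 2 * (w₁ t * w₂ t))| ≤
      s * (C * ∫ t in Ioi (0:ℝ), (t ^ k * deriv w₁ t ^ 2 + t ^ k * deriv w₂ t ^ 2
        + (t ^ k / t ^ 2 * w₁ t ^ 2 + t ^ k / t ^ 2 * w₂ t ^ 2))) := by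
  have hφ := h.contDiffOn.continuousOn
  have hψ := h.continuousOn_deriv
  have hc₁ := hw₁.1.continuousOn
  have hc₂ := hw₂.1.continuousOn
  have hd₁ := continuousOn_deriv_Ioi hw₁.1
  have hd₂ := continuousOn_deriv_Ioi hw₂.1
  have hcX : ContinuousOn (fun t => (l₁ - l₂) * (φ t ^ 2 * (t ^ k / t ^ 2 * (w₁ t * w₂ t))))
      (Ioi 0) :=
    continuousOn_const.mul ((hφ.pow 2).mul ((continuousOn_rpow_div_sq k).mul (hc₁.mul hc₂)))
  have hcY : ContinuousOn (fun t => 2 * (φ t * ψ t) * (t ^ k * (deriv w₁ t * w₂ t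
      - deriv w₂ t * w₁ t))) (Ioi 0) :=
    (continuousOn_const.mul (hφ.mul hψ)).mul ((continuousOn_rpow_Ioi k).mul
      ((hd₁.mul hc₂).sub (hd₂.mul hc₁)))
  have hiX := integrableOn_Ioi_of_eq_zero_off_Icc (b := b) h.left_pos hcX fun t ht hn => by
    simp only [h.eq_zero t ht hn]
    ring
  have hiY := integrableOn_Ioi_of_eq_zero_off_Icc (b := b) h.left_pos hcY fun t ht hn => by
    simp only [h.eq_zero t ht hn]
    ring
  have hEq : (∫ t in Ioi (0:ℝ), (l₁ - l₂) * (φ t ^ 2 * (t ^ k / t ^ 2 * (w₁ t * w₂ t)))) =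
      ∫ t in Ioi (0:ℝ), 2 * (φ t * ψ t) * (t ^ k * (deriv w₁ t * w₂ t
        - deriv w₂ t * w₁ t)) := by
    refine (sub_eq_zero.1 ?_).symm
    rw [← integral_sub hiY hiX]
    refine setIntegral_Ioi_eq_zero_of_hasDerivAt
      (G := fun t => φ t ^ 2 * (t ^ k * (deriv w₁ t * w₂ t - deriv w₂ t * w₁ t)))
      (b := b) h.left_pos (fun t ht => ?_) (hcY.sub hcX) (fun t ht hn => ?_) fun t ht hn => ?_
    · have e₁ := hasDerivAt_of_contDiffOn_Ioi hw₁.1 t ht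
      have e₂ := hasDerivAt_of_contDiffOn_Ioi hw₂.1 t ht
      have f₁ := hasDerivAt_of_contDiffOn_Ioi (contDiffOn_deriv_Ioi hw₁') t ht
      have f₂ := hasDerivAt_of_contDiffOn_Ioi (contDiffOn_deriv_Ioi hw₂') t ht
      have hd := ((h.hasDerivAt t ht).pow 2).mul ((hasDerivAt_rpow_div (k := k) ht).mul
        ((f₁.mul e₂).sub (f₂.mul e₁)))
      refine hd.congr_deriv ?_
      have hq₁ : deriv (deriv w₁) t = -(k / t * deriv w₁ t) - A t * w₁ t - l₁ / t ^ 2 * w₁ t := by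
        linarith [hode₁ t ht]
      have hq₂ : deriv (deriv w₂) t = -(k / t * deriv w₂ t) - A t * w₂ t - l₂ / t ^ 2 * w₂ t := by
        linarith [hode₂ t ht]
      simp only [Pi.pow_apply, Pi.mul_apply, Pi.sub_apply, hq₁, hq₂, Nat.cast_ofNat]
      have := ne_of_gt ht
      field_simp
      ring
    · simp only [h.eq_zero t ht hn]
      ring
    · simp only [h.eq_zero t ht hn]
      ring
  have hdom : IntegrableOn (fun t => t ^ k * deriv w₁ t ^ 2 + t ^ k * deriv w₂ t ^ 2
      + (t ^ k / t ^ 2 * w₁ t ^ 2 + t ^ k / t ^ 2 * w₂ t ^ 2)) (Ioi 0) :=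
    (hw₁.integrableOn_rpow_mul_deriv_sq.add hw₂.integrableOn_rpow_mul_deriv_sq).add
      ((hw₁.integrableOn_rpow_div_sq_mul_sq hk).add (hw₂.integrableOn_rpow_div_sq_mul_sq hk))
  rw [← abs_mul, ← integral_const_mul, hEq, ← mul_assoc, ← integral_const_mul,
    ← Real.norm_eq_abs]
  refine norm_integral_le_of_norm_le (hdom.const_mul (s * C)) ?_
  refine (ae_restrict_iff' measurableSet_Ioi).2 (.of_forall fun t ht => ?_)
  have ht : 0 < t := ht
  have hkp := Real.rpow_pos_of_pos ht k
  rw [Real.norm_eq_abs, abs_mul, abs_mul, abs_mul, abs_mul, abs_of_nonneg (h.nonneg t),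
    abs_of_pos hkp, abs_two]
  have h1 : φ t * |ψ t| ≤ C * s / t :=
    (mul_le_of_le_one_left (abs_nonneg _) (h.le_one t)).trans (h.abs_deriv_le t ht)
  have h2 : |deriv w₁ t * w₂ t - deriv w₂ t * w₁ t| ≤
      |deriv w₁ t| * |w₂ t| + |deriv w₂ t| * |w₁ t| := by
    rw [← abs_mul, ← abs_mul]
    exact abs_sub _ _
  calc 2 * (φ t * |ψ t|) * (t ^ k * |deriv w₁ t * w₂ t - deriv w₂ t * w₁ t|)
      ≤ 2 * (C * s / t) * (t ^ k * (|deriv w₁ t| * |w₂ t| + |deriv w₂ t| * |w₁ t|)) := by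
        gcongr
    _ ≤ _ := by
        rw [← sq_abs (deriv w₁ t), ← sq_abs (deriv w₂ t), ← sq_abs (w₁ t), ← sq_abs (w₂ t)]
        rw [← sub_nonneg]
        have : s * C * (t ^ k * |deriv w₁ t| ^ 2 + t ^ k * |deriv w₂ t| ^ 2
            + (t ^ k / t ^ 2 * |w₁ t| ^ 2 + t ^ k / t ^ 2 * |w₂ t| ^ 2))
            - 2 * (C * s / t) * (t ^ k * (|deriv w₁ t| * |w₂ t| + |deriv w₂ t| * |w₁ t|))
            = s * C * t ^ k * ((|deriv w₁ t| - |w₂ t| / t) ^ 2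
              + (|deriv w₂ t| - |w₁ t| / t) ^ 2) := by
          field_simp
          ring
        rw [this]
        positivity

end IsLogCutoff

theorem exists_pos_le_integral_cutoff {k : ℝ} {w : ℝ → ℝ} (C : ℝ) (hw : ContinuousOn w (Ioi 0))
    (hne : ∃ t ∈ Ioi (0:ℝ), w t ≠ 0) :
    ∃ m > (0:ℝ), ∃ s₀ > (0:ℝ), ∀ s ∈ Ioo 0 s₀, ∀ φ ψ a b, IsLogCutoff C s φ ψ a b →
      IntegrableOn (fun t => φ t ^ 2 * (t ^ k / t ^ 2 * w t ^ 2)) (Ioi 0) ∧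
      m ≤ ∫ t in Ioi (0:ℝ), φ t ^ 2 * (t ^ k / t ^ 2 * w t ^ 2) := by
  obtain ⟨t₀, ht₀, hwt₀⟩ := hne
  have ht₀ : 0 < t₀ := ht₀
  have hc : ContinuousOn (fun t => t ^ k / t ^ 2 * w t ^ 2) (Ioi 0) :=
    (continuousOn_rpow_div_sq k).mul (hw.pow 2)
  have hnn : ∀ t > (0:ℝ), 0 ≤ t ^ k / t ^ 2 * w t ^ 2 := fun t ht => by
    have := Real.rpow_nonneg ht.le k
    positivity
  have hpos := setIntegral_Ioc_pos_of_continuousOn hc hnn ht₀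
    (by have := Real.rpow_pos_of_pos ht₀ k; positivity)
  have hsub : Icc (t₀ / 2) (2 * t₀) ⊆ Ioi 0 := fun t ht =>
    lt_of_lt_of_le (by linarith) ht.1
  obtain ⟨L, hL⟩ := isCompact_Icc.exists_bound_of_continuousOn
    (Real.continuousOn_log.mono fun t (ht : t ∈ Icc (t₀ / 2) (2 * t₀)) => ne_of_gt (hsub ht))
  have hL0 : 0 ≤ L := (norm_nonneg _).trans (hL t₀ ⟨by linarith, by linarith⟩)
  refine ⟨_, hpos, 1 / (L + 1), by positivity, fun s hs φ ψ a b h => ?_⟩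
  have hint : IntegrableOn (fun t => φ t ^ 2 * (t ^ k / t ^ 2 * w t ^ 2)) (Ioi 0) :=
    integrableOn_Ioi_of_eq_zero_off_Icc (b := b) h.left_pos
      ((h.contDiffOn.continuousOn.pow 2).mul hc) fun t ht hn => by
        simp only [h.eq_zero t ht hn]
        ring
  refine ⟨hint, ?_⟩
  have heq : ∫ t in Ioc (t₀ / 2) (2 * t₀), t ^ k / t ^ 2 * w t ^ 2 =
      ∫ t in Ioc (t₀ / 2) (2 * t₀), φ t ^ 2 * (t ^ k / t ^ 2 * w t ^ 2) := by
    refine setIntegral_congr_fun measurableSet_Ioc fun t ht => ?_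
    have ht := Ioc_subset_Icc_self ht
    have hl := hL t ht
    have h1 : s * |Real.log t| ≤ 1 := by
      have hs2 : s * (L + 1) < 1 := (lt_div_iff₀ (by positivity)).1 hs.2
      have := mul_le_mul_of_nonneg_left hl hs.1.le
      rw [Real.norm_eq_abs] at this
      linarith [hs.1]
    simp only [h.eq_one t (hsub ht) h1]
    ring
  rw [heq]
  refine setIntegral_mono_set hint ?_ (LE.le.eventuallyLE (Ioc_subset_Icc_self.trans hsub))
  exact (ae_restrict_iff' measurableSet_Ioi).2 (.of_forall fun t ht =>
    mul_nonneg (sq_nonneg _) (hnn t ht))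

theorem Ray_neg_of_energy_neg {k : ℝ} {A u : ℝ → ℝ} (hu : memE k u)
    (hneg : ∫ t in Ioi (0:ℝ), t ^ k * ((deriv u t) ^ 2 - A t * (u t) ^ 2) < 0) :
    (∃ t ∈ Ioi (0:ℝ), u t ≠ 0) ∧ Ray k A u < 0 := by
  have hne : ∃ t ∈ Ioi (0:ℝ), u t ≠ 0 := by
    by_contra! h0
    refine hneg.ne (setIntegral_eq_zero_of_forall_eq_zero fun t ht => ?_)
    have hd : deriv u t = 0 := by
      have : u =ᶠ[𝓝 t] fun _ => 0 := by
        filter_upwards [Ioi_mem_nhds ht] with x hx using h0 x hx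
      rw [this.deriv_eq, deriv_const]
    rw [hd, h0 t ht]
    ring
  refine ⟨hne, div_neg_of_neg_of_pos hneg ?_⟩
  obtain ⟨t₀, ht₀, hut₀⟩ := hne
  have ht₀ : 0 < t₀ := ht₀
  have hnn : ∀ t > (0:ℝ), 0 ≤ t ^ k * u t ^ 2 := fun t ht =>
    mul_nonneg (Real.rpow_nonneg ht.le k) (sq_nonneg _)
  have hpos := setIntegral_Ioc_pos_of_continuousOn
    ((continuousOn_rpow_Ioi k).mul (hu.1.continuousOn.pow 2)) hnn ht₀
    (mul_pos (Real.rpow_pos_of_pos ht₀ k) (pow_pos (abs_pos.2 hut₀) 2 |>.trans_eq (sq_abs _)))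
  refine hpos.trans_le (setIntegral_mono_set hu.integrableOn_rpow_mul_sq
    ((ae_restrict_iff' measurableSet_Ioi).2 (.of_forall hnn)) (LE.le.eventuallyLE fun t ht => ?_))
  exact lt_trans (by linarith) ht.1

theorem stmt8 (k : ℝ) (hk : 1 < k) (F : ℝ → ℝ) (hF : ContDiff ℝ 1 F)
    (V : ℝ → ℝ) (hV : ContDiffOn ℝ 2 V (Ioi 0)) (hVpos : ∀ t > (0:ℝ), 0 < V t)
    (hode : ∀ t > (0:ℝ), -(deriv (deriv V) t) - k / t * deriv V t = F (V t))
    (hmorse : MorseIndexOne k (fun t => deriv F (V t))) :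
    ¬ ∃ (l₁ l₂ : ℝ) (w₁ w₂ : ℝ → ℝ), l₁ ≠ l₂ ∧ l₁ < 0 ∧ l₂ < 0 ∧
      (memE k w₁ ∧ ContDiffOn ℝ 2 w₁ (Ioi 0) ∧ (∃ t ∈ Ioi (0:ℝ), w₁ t ≠ 0) ∧
        ∀ t > (0:ℝ), -(deriv (deriv w₁) t) - k / t * deriv w₁ t
          = deriv F (V t) * w₁ t + l₁ / t ^ 2 * w₁ t) ∧
      (memE k w₂ ∧ ContDiffOn ℝ 2 w₂ (Ioi 0) ∧ (∃ t ∈ Ioi (0:ℝ), w₂ t ≠ 0) ∧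
        ∀ t > (0:ℝ), -(deriv (deriv w₂) t) - k / t * deriv w₂ t
          = deriv F (V t) * w₂ t + l₂ / t ^ 2 * w₂ t) := by
  rintro ⟨l₁, l₂, w₁, w₂, hl, hl₁, hl₂, ⟨hw₁, hw₁', hne₁, hode₁⟩, ⟨hw₂, hw₂', hne₂, hode₂⟩⟩
  set A : ℝ → ℝ := fun t => deriv F (V t) with hA_def
  have hA : ContinuousOn A (Ioi 0) :=
    (hF.continuous_deriv le_rfl).comp_continuousOn hV.continuousOn
  obtain ⟨C, hC, hcut⟩ := exists_isLogCutoff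
  obtain ⟨m₁, hm₁, s₁, hs₁, hlow₁⟩ :=
    exists_pos_le_integral_cutoff (k := k) C hw₁.1.continuousOn hne₁
  obtain ⟨m₂, hm₂, s₂, hs₂, hlow₂⟩ :=
    exists_pos_le_integral_cutoff (k := k) C hw₂.1.continuousOn hne₂
  have hN₁ := hw₁.integrableOn_rpow_div_sq_mul_sq hk
  have hN₂ := hw₂.integrableOn_rpow_div_sq_mul_sq hk
  set N₁ := ∫ t in Ioi (0:ℝ), t ^ k / t ^ 2 * w₁ t ^ 2 with hN₁_def
  set N₂ := ∫ t in Ioi (0:ℝ), t ^ k / t ^ 2 * w₂ t ^ 2 with hN₂_def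
  set K := (C * ∫ t in Ioi (0:ℝ), (t ^ k * deriv w₁ t ^ 2 + t ^ k * deriv w₂ t ^ 2
    + (t ^ k / t ^ 2 * w₁ t ^ 2 + t ^ k / t ^ 2 * w₂ t ^ 2))) / |l₁ - l₂| with hK
  have hsmall : ∀ l m N : ℝ, l < 0 → 0 < m → ∀ᶠ s in 𝓝[>] (0:ℝ),
      l * m + 2 * C ^ 2 * s ^ 2 * N + |l₁ + l₂| * (s * K) / 2 < 0 := by
    intro l m N hl hm
    have hc : Continuous fun s : ℝ =>
        l * m + 2 * C ^ 2 * s ^ 2 * N + |l₁ + l₂| * (s * K) / 2 := by fun_prop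
    refine nhdsWithin_le_nhds (hc.tendsto 0 |>.eventually_lt_const ?_)
    have := mul_neg_of_neg_of_pos hl hm
    simpa using this
  obtain ⟨s, ⟨⟨hneg₁, hneg₂⟩, hss₁⟩, hss₂⟩ := (((hsmall l₁ m₁ N₁ hl₁ hm₁).and
    (hsmall l₂ m₂ N₂ hl₂ hm₂)).and (Ioo_mem_nhdsGT hs₁)).and (Ioo_mem_nhdsGT hs₂) |>.exists
  have hs : 0 < s := hss₁.1
  obtain ⟨φ, ψ, a, b, h⟩ := hcut s hs
  obtain ⟨hM₁, hmM₁⟩ := hlow₁ s hss₁ φ ψ a b h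
  obtain ⟨hM₂, hmM₂⟩ := hlow₂ s hss₂ φ ψ a b h
  set M₁ := ∫ t in Ioi (0:ℝ), φ t ^ 2 * (t ^ k / t ^ 2 * w₁ t ^ 2) with hM₁_def
  set M₂ := ∫ t in Ioi (0:ℝ), φ t ^ 2 * (t ^ k / t ^ 2 * w₂ t ^ 2) with hM₂_def
  have hX := h.abs_integral_mul_le hC hs hk hw₁ hw₂ hw₁' hw₂' hode₁ hode₂
  have hXint : IntegrableOn (fun t => φ t ^ 2 * (t ^ k / t ^ 2 * (w₁ t * w₂ t))) (Ioi 0) :=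
    integrableOn_Ioi_of_eq_zero_off_Icc (b := b) h.left_pos
      ((h.contDiffOn.continuousOn.pow 2).mul ((continuousOn_rpow_div_sq k).mul
        (hw₁.1.continuousOn.mul hw₂.1.continuousOn))) fun t ht hn => by
          simp only [h.eq_zero t ht hn]
          ring
  set X := ∫ t in Ioi (0:ℝ), φ t ^ 2 * (t ^ k / t ^ 2 * (w₁ t * w₂ t)) with hX_def
  have hXK : |X| ≤ s * K := by
    rw [hK, ← mul_div_assoc, le_div_iff₀ (abs_pos.2 (sub_ne_zero.2 hl)), mul_comm]
    exact hX
  have hd₁ := hasDerivAt_of_contDiffOn_Ioi hw₁.1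
  have hd₂ := hasDerivAt_of_contDiffOn_Ioi hw₂.1
  have hdd₁ := hasDerivAt_of_contDiffOn_Ioi (contDiffOn_deriv_Ioi hw₁')
  have hdd₂ := hasDerivAt_of_contDiffOn_Ioi (contDiffOn_deriv_Ioi hw₂')
  have key : ∀ c₁ c₂ : ℝ, ¬(c₁ = 0 ∧ c₂ = 0) →
      (∃ t ∈ Ioi (0:ℝ), c₁ * (φ t * w₁ t) + c₂ * (φ t * w₂ t) ≠ 0) ∧
      Ray k A (fun t => c₁ * (φ t * w₁ t) + c₂ * (φ t * w₂ t)) < 0 := by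
    intro c₁ c₂ hc
    have hfun : (fun t => c₁ * (φ t * w₁ t) + c₂ * (φ t * w₂ t)) =
        fun t => φ t * (c₁ * w₁ t + c₂ * w₂ t) := by
      funext t
      ring
    have hdw : ∀ t > (0:ℝ), HasDerivAt (fun t => c₁ * w₁ t + c₂ * w₂ t)
        (c₁ * deriv w₁ t + c₂ * deriv w₂ t) t := fun t ht =>
      ((hd₁ t ht).const_mul c₁).add ((hd₂ t ht).const_mul c₂)
    refine Ray_neg_of_energy_neg (u := fun t => c₁ * (φ t * w₁ t) + c₂ * (φ t * w₂ t)) ?_ ?_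
    · rw [hfun]
      exact h.memE_mul ((contDiffOn_const.mul hw₁.1).add (contDiffOn_const.mul hw₂.1))
    obtain ⟨hint, heq⟩ := h.integral_energy_eq (k := k) (A := A)
      (g := fun t => c₁ * l₁ * w₁ t + c₂ * l₂ * w₂ t) (w := fun t => c₁ * w₁ t + c₂ * w₂ t)
      (p := fun t => c₁ * deriv w₁ t + c₂ * deriv w₂ t)
      (q := fun t => c₁ * deriv (deriv w₁) t + c₂ * deriv (deriv w₂) t) hA
      ((continuousOn_const.mul hw₁.1.continuousOn).add
        (continuousOn_const.mul hw₂.1.continuousOn)) hdw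
      (fun t ht => ((hdd₁ t ht).const_mul c₁).add ((hdd₂ t ht).const_mul c₂))
      (fun t ht => by
        have e₁ := hode₁ t ht
        have e₂ := hode₂ t ht
        simp only [hA_def]
        linear_combination c₁ * e₁ + c₂ * e₂)
    have hcongr : ∫ t in Ioi (0:ℝ), t ^ k *
        ((deriv (fun t => c₁ * (φ t * w₁ t) + c₂ * (φ t * w₂ t)) t) ^ 2
          - A t * (c₁ * (φ t * w₁ t) + c₂ * (φ t * w₂ t)) ^ 2) =
        ∫ t in Ioi (0:ℝ), t ^ k * ((ψ t * (c₁ * w₁ t + c₂ * w₂ t)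
          + φ t * (c₁ * deriv w₁ t + c₂ * deriv w₂ t)) ^ 2
          - A t * (φ t * (c₁ * w₁ t + c₂ * w₂ t)) ^ 2) := by
      refine setIntegral_congr_fun measurableSet_Ioi fun t ht => ?_
      have hd : deriv (fun t => φ t * (c₁ * w₁ t + c₂ * w₂ t)) t = _ :=
        ((h.hasDerivAt t ht).mul (hdw t ht)).deriv
      simp only [hfun, hd]
      ring
    rw [hcongr, heq]
    have hi₁ := hN₁.const_mul (2 * C ^ 2 * s ^ 2 * c₁ ^ 2)
    have hi₂ := hN₂.const_mul (2 * C ^ 2 * s ^ 2 * c₂ ^ 2)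
    have hi₃ := hM₁.const_mul (l₁ * c₁ ^ 2)
    have hi₄ := hM₂.const_mul (l₂ * c₂ ^ 2)
    have hi₅ := hXint.const_mul (c₁ * c₂ * (l₁ + l₂))
    have hle := setIntegral_mono_on hint ((((hi₁.add hi₂).add hi₃).add hi₄).add hi₅)
      measurableSet_Ioi fun t ht => ?_
    · refine hle.trans_lt ?_
      rw [integral_add' (((hi₁.add hi₂).add hi₃).add hi₄) hi₅,
        integral_add' ((hi₁.add hi₂).add hi₃) hi₄, integral_add' (hi₁.add hi₂) hi₃,
        integral_add' hi₁ hi₂]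
      simp only [integral_const_mul]
      rw [← hN₁_def, ← hN₂_def, ← hM₁_def, ← hM₂_def, ← hX_def]
      have hcross : c₁ * c₂ * (l₁ + l₂) * X ≤ |l₁ + l₂| * (s * K) / 2 * (c₁ ^ 2 + c₂ ^ 2) := by
        have h1 : |c₁ * c₂| ≤ (c₁ ^ 2 + c₂ ^ 2) / 2 := by
          rw [abs_mul, ← sq_abs c₁, ← sq_abs c₂]
          nlinarith [sq_nonneg (|c₁| - |c₂|)]
        calc c₁ * c₂ * (l₁ + l₂) * X ≤ |c₁ * c₂ * (l₁ + l₂) * X| := le_abs_self _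
          _ = |c₁ * c₂| * |l₁ + l₂| * |X| := by rw [abs_mul, abs_mul]
          _ ≤ (c₁ ^ 2 + c₂ ^ 2) / 2 * |l₁ + l₂| * (s * K) := by gcongr
          _ = _ := by ring
      have hb₁ : l₁ * c₁ ^ 2 * M₁ ≤ l₁ * c₁ ^ 2 * m₁ :=
        mul_le_mul_of_nonpos_left hmM₁ (mul_nonpos_of_nonpos_of_nonneg hl₁.le (sq_nonneg _))
      have hb₂ : l₂ * c₂ ^ 2 * M₂ ≤ l₂ * c₂ ^ 2 * m₂ :=
        mul_le_mul_of_nonpos_left hmM₂ (mul_nonpos_of_nonpos_of_nonneg hl₂.le (sq_nonneg _))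
      have hfin : c₁ ^ 2 * (l₁ * m₁ + 2 * C ^ 2 * s ^ 2 * N₁ + |l₁ + l₂| * (s * K) / 2)
          + c₂ ^ 2 * (l₂ * m₂ + 2 * C ^ 2 * s ^ 2 * N₂ + |l₁ + l₂| * (s * K) / 2) < 0 := by
        by_cases hc₁ : c₁ = 0
        · have hc₂ : c₂ ≠ 0 := fun hc₂ => hc ⟨hc₁, hc₂⟩
          exact add_neg_of_nonpos_of_neg (mul_nonpos_of_nonneg_of_nonpos (sq_nonneg _) hneg₁.le)
            (mul_neg_of_pos_of_neg (by positivity) hneg₂)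
        · exact add_neg_of_neg_of_nonpos (mul_neg_of_pos_of_neg (by positivity) hneg₁)
            (mul_nonpos_of_nonneg_of_nonpos (sq_nonneg _) hneg₂.le)
      linarith
    · have ht : 0 < t := ht
      have hkp := Real.rpow_pos_of_pos ht k
      simp only [Pi.add_apply]
      have hψ2 : ψ t ^ 2 ≤ C ^ 2 * s ^ 2 / t ^ 2 := by
        rw [← sq_abs, ← mul_pow, ← div_pow]
        exact pow_le_pow_left₀ (abs_nonneg _) (h.abs_deriv_le t ht) 2
      have hsq : (c₁ * w₁ t + c₂ * w₂ t) ^ 2 ≤ 2 * (c₁ ^ 2 * w₁ t ^ 2 + c₂ ^ 2 * w₂ t ^ 2) := by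
        nlinarith [sq_nonneg (c₁ * w₁ t - c₂ * w₂ t)]
      have hfirst : t ^ k * ψ t ^ 2 * (c₁ * w₁ t + c₂ * w₂ t) ^ 2 ≤
          t ^ k * (C ^ 2 * s ^ 2 / t ^ 2) * (2 * (c₁ ^ 2 * w₁ t ^ 2 + c₂ ^ 2 * w₂ t ^ 2)) := by
        gcongr
      refine (add_le_add_left hfirst _).trans (le_of_eq ?_)
      ring
  obtain ⟨c₁, c₂, hc, hR⟩ := hmorse.2 (fun t => φ t * w₁ t) (fun t => φ t * w₂ t)
    (h.memE_mul hw₁.1) (h.memE_mul hw₂.1) fun c₁ c₂ h0 => by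
      by_contra hc
      obtain ⟨t, ht, hne⟩ := (key c₁ c₂ hc).1
      exact hne (h0 t ht)
  exact absurd hR (not_le.2 (key c₁ c₂ hc).2)
end

section
/- Let k > 1, m > 0, and let F : ℝ → ℝ be continuously differentiable with F(0) = 0 and F'(0) = -m. Suppose V ∈ C²((0,∞)) is a positive solution of -V''(t) - (k/t)V'(t) = F(V(t)) on (0,∞) with lim_{t→0⁺} V'(t) = 0 and lim_{t→∞} V(t) = 0. Then for every δ ∈ (0, √m) there exist constants C > 0, C₁ > 0 and t₀ > 0 such that V(t) ≤ C·t^{-k/2}·e^{-δt} and |V'(t)| ≤ C₁·t^{-k/2}·e^{-δt} for all t ≥ t₀. -/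
open MeasureTheory Filter Set Topology

theorem monotoneOn_Ici_of_hasDerivAt_nonneg {f f' : ℝ → ℝ} {T : ℝ}
    (hf : ∀ t ≥ T, HasDerivAt f (f' t) t) (hf' : ∀ t ≥ T, 0 ≤ f' t) :
    MonotoneOn f (Ici T) := by
  refine monotoneOn_of_hasDerivWithinAt_nonneg (f' := f') (convex_Ici T)
    (fun t ht => (hf t ht).continuousAt.continuousWithinAt) (fun t ht => ?_) (fun t ht => ?_)
  · exact (hf t (interior_subset ht)).hasDerivWithinAt
  · exact hf' t (interior_subset ht)

/-- A function whose derivative at `0` is `-m` and which vanishes at `0` satisfies `c * v ≤ -F v`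
for small positive `v`, for every `c < m`. -/
theorem eventually_mul_le_neg_of_hasDerivAt_neg {F : ℝ → ℝ} {c m : ℝ} (hc : c < m)
    (hF : HasDerivAt F (-m) 0) (hF0 : F 0 = 0) :
    ∀ᶠ v in 𝓝[>] (0 : ℝ), c * v ≤ -F v := by
  have h := hF.tendsto_slope.mono_left (nhdsWithin_mono 0 fun v (hv : 0 < v) => hv.ne')
  filter_upwards [h.eventually (gt_mem_nhds (neg_lt_neg hc)), self_mem_nhdsWithin] with v hv hv0
  have hv0 : 0 < v := hv0
  rw [slope_def_field, hF0, sub_zero, sub_zero, div_lt_iff₀ hv0] at hv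
  linarith

section

variable {k μ T : ℝ} {V V₁ V₂ : ℝ → ℝ}

/-- A positive solution of `V'' + (k / t) V' ≥ 0` that tends to `0` is eventually strictly
decreasing. -/
theorem deriv_neg_of_tendsto_zero (hT : 0 < T)
    (hV : ∀ t ≥ T, HasDerivAt V (V₁ t) t) (hV₁ : ∀ t ≥ T, HasDerivAt V₁ (V₂ t) t)
    (hpos : ∀ t ≥ T, 0 < V t) (hode : ∀ t ≥ T, 0 ≤ V₂ t + k / t * V₁ t)
    (hlim : Tendsto V atTop (𝓝 0)) : ∀ t ≥ T, V₁ t < 0 := by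
  have hmono : MonotoneOn (fun t => t ^ k * V₁ t) (Ici T) := by
    refine monotoneOn_Ici_of_hasDerivAt_nonneg (fun t ht =>
      (Real.hasDerivAt_rpow_const (p := k) (Or.inl (hT.trans_le ht).ne')).mul (hV₁ t ht))
      fun t ht => ?_
    have ht0 : 0 < t := hT.trans_le ht
    have : k * t ^ (k - 1) * V₁ t + t ^ k * V₂ t = t ^ k * (V₂ t + k / t * V₁ t) := by
      rw [Real.rpow_sub_one ht0.ne']
      ring
    rw [this]
    exact mul_nonneg (Real.rpow_nonneg ht0.le k) (hode t ht)
  intro s hs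
  by_contra! h
  have hV₁nonneg : ∀ t ≥ s, 0 ≤ V₁ t := fun t ht => by
    have h1 : s ^ k * V₁ s ≤ t ^ k * V₁ t := hmono hs (hs.trans ht : T ≤ t) ht
    have h2 : 0 ≤ s ^ k * V₁ s := mul_nonneg (Real.rpow_nonneg (hT.trans_le hs).le k) h
    exact nonneg_of_mul_nonneg_right (h2.trans h1)
      (Real.rpow_pos_of_pos (hT.trans_le (hs.trans ht)) k)
  have hVmono : MonotoneOn V (Ici s) :=
    monotoneOn_Ici_of_hasDerivAt_nonneg (fun t ht => hV t (hs.trans ht)) hV₁nonneg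
  have : V s ≤ 0 := ge_of_tendsto hlim <|
    (eventually_ge_atTop s).mono fun t ht => hVmono self_mem_Ici ht ht
  exact (hpos s hs).not_ge this

/-- A positive decreasing solution of `V'' ≥ μ² V` that tends to `0` satisfies `V' ≤ -μ V`. -/
theorem deriv_le_neg_mul (hμ : 0 < μ)
    (hV : ∀ t ≥ T, HasDerivAt V (V₁ t) t) (hV₁ : ∀ t ≥ T, HasDerivAt V₁ (V₂ t) t)
    (hneg : ∀ t ≥ T, V₁ t < 0) (hode : ∀ t ≥ T, μ ^ 2 * V t ≤ V₂ t)
    (hlim : Tendsto V atTop (𝓝 0)) : ∀ t ≥ T, V₁ t ≤ -μ * V t := by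
  have hmono : MonotoneOn (fun t => Real.exp (-μ * t) * (V₁ t + μ * V t)) (Ici T) := by
    refine monotoneOn_Ici_of_hasDerivAt_nonneg (fun t ht =>
      (((hasDerivAt_id t).const_mul (-μ)).exp).mul ((hV₁ t ht).add ((hV t ht).const_mul μ)))
      fun t ht => ?_
    have := mul_nonneg (Real.exp_nonneg (-μ * t)) (sub_nonneg.2 (hode t ht))
    simp only [id]
    linarith
  intro s hs
  have hlim' : Tendsto (fun t => Real.exp (-μ * t) * (μ * V t)) atTop (𝓝 0) := by
    have h1 : Tendsto (fun t => Real.exp (-μ * t)) atTop (𝓝 0) :=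
      Real.tendsto_exp_atBot.comp (tendsto_id.const_mul_atTop_of_neg (neg_lt_zero.2 hμ))
    simpa using h1.mul (hlim.const_mul μ)
  have h : Real.exp (-μ * s) * (V₁ s + μ * V s) ≤ 0 := ge_of_tendsto hlim' <|
    (eventually_ge_atTop s).mono fun t ht => by
      refine (hmono hs (hs.trans ht : T ≤ t) ht).trans ?_
      have := hneg t (hs.trans ht)
      exact mul_le_mul_of_nonneg_left (by linarith) (Real.exp_nonneg _)
  have := nonpos_of_mul_nonpos_right h (Real.exp_pos _)
  linarith

/-- Exponential decay of `V` when `V' ≤ -μ V`. -/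
theorem le_mul_exp_of_deriv_le_neg_mul
    (hV : ∀ t ≥ T, HasDerivAt V (V₁ t) t) (hle : ∀ t ≥ T, V₁ t ≤ -μ * V t) :
    ∀ t ≥ T, V t ≤ V T * Real.exp (μ * T) * Real.exp (-μ * t) := by
  have hmono : MonotoneOn (fun t => -(Real.exp (μ * t) * V t)) (Ici T) := by
    refine monotoneOn_Ici_of_hasDerivAt_nonneg (fun t ht =>
      ((((hasDerivAt_id t).const_mul μ).exp).mul (hV t ht)).neg) fun t ht => ?_
    have := mul_nonneg (Real.exp_nonneg (μ * t)) (sub_nonneg.2 (hle t ht))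
    simp only [id]
    linarith
  intro t ht
  have h : -(Real.exp (μ * T) * V T) ≤ -(Real.exp (μ * t) * V t) := hmono self_mem_Ici ht ht
  have h1 : Real.exp (μ * t) * Real.exp (-μ * t) = 1 := by
    rw [← Real.exp_add]
    simp
  calc V t = Real.exp (μ * t) * V t * Real.exp (-μ * t) := by linear_combination -V t * h1
    _ ≤ V T * Real.exp (μ * T) * Real.exp (-μ * t) :=
      mul_le_mul_of_nonneg_right (by linarith) (Real.exp_nonneg _)

/-- For a positive, decreasing, convex function, `|V' t|` is at most `V (t - 1)`. -/
theorem abs_deriv_le_sub_one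
    (hV : ∀ t ≥ T, HasDerivAt V (V₁ t) t) (hV₁ : ∀ t ≥ T, HasDerivAt V₁ (V₂ t) t)
    (hpos : ∀ t ≥ T, 0 < V t) (hneg : ∀ t ≥ T, V₁ t < 0) (hconv : ∀ t ≥ T, 0 ≤ V₂ t) :
    ∀ t ≥ T + 1, |V₁ t| ≤ V (t - 1) := by
  intro t ht
  obtain ⟨c, hc, hc'⟩ := exists_hasDerivAt_eq_slope V V₁ (sub_one_lt t)
    (fun x hx => (hV x (by linarith [hx.1])).continuousAt.continuousWithinAt)
    (fun x hx => hV x (by linarith [hx.1]))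
  have hmono : V₁ c ≤ V₁ t := monotoneOn_Ici_of_hasDerivAt_nonneg hV₁ hconv
    (by linarith [hc.1] : T ≤ c) (by linarith : T ≤ t) hc.2.le
  rw [sub_sub_cancel, div_one] at hc'
  rw [abs_of_neg (hneg t (by linarith))]
  linarith [hpos t (by linarith)]

end

theorem eventually_exp_le_rpow_mul_exp (s : ℝ) {δ μ : ℝ} (h : δ < μ) :
    ∀ᶠ t : ℝ in atTop, Real.exp (-μ * t) ≤ t ^ (-s) * Real.exp (-δ * t) := by
  have hlim := tendsto_rpow_mul_exp_neg_mul_atTop_nhds_zero s (μ - δ) (sub_pos.2 h)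
  filter_upwards [hlim.eventually (gt_mem_nhds one_pos), eventually_gt_atTop 0] with t ht ht0
  have h1 : t ^ (-s) * t ^ s = 1 := by rw [← Real.rpow_add ht0]; simp
  have h2 : Real.exp (-μ * t) = Real.exp (-(μ - δ) * t) * Real.exp (-δ * t) := by
    rw [← Real.exp_add]
    ring_nf
  rw [h2]
  refine mul_le_mul_of_nonneg_right ?_ (Real.exp_nonneg _)
  calc Real.exp (-(μ - δ) * t) = t ^ (-s) * (t ^ s * Real.exp (-(μ - δ) * t)) := by
        rw [← mul_assoc, h1, one_mul]
    _ ≤ t ^ (-s) * 1 := mul_le_mul_of_nonneg_left ht.le (Real.rpow_nonneg ht0.le _)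
    _ = t ^ (-s) := mul_one _

open MeasureTheory Filter Set Topology

theorem stmt9 (k m : ℝ) (hk : 1 < k) (hm : 0 < m)
    (F : ℝ → ℝ) (hF : ContDiff ℝ 1 F) (hF0 : F 0 = 0) (hF'0 : deriv F 0 = -m)
    (V : ℝ → ℝ) (hV : ContDiffOn ℝ 2 V (Ioi 0)) (hVpos : ∀ t > (0:ℝ), 0 < V t)
    (hode : ∀ t > (0:ℝ), -(deriv (deriv V) t) - k / t * deriv V t = F (V t))
    (hV'0 : Tendsto (deriv V) (𝓝[>] 0) (𝓝 0))
    (hVinf : Tendsto V atTop (𝓝 0)) :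
    ∀ δ ∈ Ioo 0 (Real.sqrt m),
      ∃ C C₁ t₀ : ℝ, 0 < C ∧ 0 < C₁ ∧ 0 < t₀ ∧
        ∀ t ≥ t₀,
          V t ≤ C * t ^ (-(k / 2)) * Real.exp (-δ * t) ∧
          |deriv V t| ≤ C₁ * t ^ (-(k / 2)) * Real.exp (-δ * t) := by
  rintro δ ⟨hδ0, hδm⟩
  obtain ⟨μ, hδμ, hμm⟩ := exists_between hδm
  have hμ0 : 0 < μ := hδ0.trans hδμ
  have hμ2 : μ ^ 2 < m := (Real.lt_sqrt hμ0.le).1 hμm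
  have hFd : HasDerivAt F (-m) 0 := hF'0 ▸ (hF.differentiable one_ne_zero 0).hasDerivAt
  have hd : ∀ t > (0 : ℝ), HasDerivAt V (deriv V t) t := fun t ht =>
    ((hV.differentiableOn two_ne_zero).differentiableAt (Ioi_mem_nhds ht)).hasDerivAt
  have hd' : ∀ t > (0 : ℝ), HasDerivAt (deriv V) (deriv (deriv V) t) t := fun t ht =>
    (((hV.deriv_of_isOpen (m := 1) isOpen_Ioi (by norm_num)).differentiableOn
      one_ne_zero).differentiableAt (Ioi_mem_nhds ht)).hasDerivAt
  have hVinf' : Tendsto V atTop (𝓝[>] 0) := tendsto_nhdsWithin_iff.2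
    ⟨hVinf, (eventually_gt_atTop 0).mono hVpos⟩
  obtain ⟨T, hT⟩ := eventually_atTop.1 ((hVinf'.eventually
    (eventually_mul_le_neg_of_hasDerivAt_neg hμ2 hFd hF0)).and (eventually_gt_atTop 0))
  have hT0 : 0 < T := (hT T le_rfl).2
  have hdT : ∀ t ≥ T, HasDerivAt V (deriv V t) t := fun t ht => hd t (hT t ht).2
  have hdT' : ∀ t ≥ T, HasDerivAt (deriv V) (deriv (deriv V) t) t := fun t ht => hd' t (hT t ht).2
  have hposT : ∀ t ≥ T, 0 < V t := fun t ht => hVpos t (hT t ht).2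
  have hsuper : ∀ t ≥ T, μ ^ 2 * V t ≤ deriv (deriv V) t + k / t * deriv V t := fun t ht => by
    linarith [(hT t ht).1, hode t (hT t ht).2]
  have hnonneg : ∀ t ≥ T, 0 ≤ μ ^ 2 * V t := fun t ht =>
    mul_nonneg (sq_nonneg μ) (hposT t ht).le
  have hneg : ∀ t ≥ T, deriv V t < 0 := deriv_neg_of_tendsto_zero hT0 hdT hdT' hposT
    (fun t ht => (hnonneg t ht).trans (hsuper t ht)) hVinf
  have hconv : ∀ t ≥ T, μ ^ 2 * V t ≤ deriv (deriv V) t := fun t ht => by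
    have : k / t * deriv V t ≤ 0 := mul_nonpos_of_nonneg_of_nonpos
      (div_nonneg (by linarith) (hT t ht).2.le) (hneg t ht).le
    linarith [hsuper t ht]
  have hdecay := le_mul_exp_of_deriv_le_neg_mul hdT
    (deriv_le_neg_mul hμ0 hdT hdT' hneg hconv hVinf)
  have habs := abs_deriv_le_sub_one hdT hdT' hposT hneg
    fun t ht => (hnonneg t ht).trans (hconv t ht)
  obtain ⟨S, hS⟩ := eventually_atTop.1 (eventually_exp_le_rpow_mul_exp (k / 2) hδμ)
  set A := V T * Real.exp (μ * T)
  have hA0 : 0 < A := mul_pos (hposT T le_rfl) (Real.exp_pos _)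
  refine ⟨A, A * Real.exp μ, max S (T + 1), hA0, mul_pos hA0 (Real.exp_pos _),
    lt_max_of_lt_right (by linarith), fun t ht => ?_⟩
  have htS : S ≤ t := (le_max_left _ _).trans ht
  have htT : T + 1 ≤ t := (le_max_right _ _).trans ht
  constructor
  · calc V t ≤ A * Real.exp (-μ * t) := hdecay t (by linarith)
      _ ≤ A * (t ^ (-(k / 2)) * Real.exp (-δ * t)) :=
        mul_le_mul_of_nonneg_left (hS t htS) hA0.le
      _ = _ := by ring
  · calc |deriv V t| ≤ V (t - 1) := habs t htT
      _ ≤ A * Real.exp (-μ * (t - 1)) := hdecay (t - 1) (by linarith)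
      _ = A * Real.exp μ * Real.exp (-μ * t) := by
        rw [show -μ * (t - 1) = μ + -μ * t by ring, Real.exp_add, ← mul_assoc]
      _ ≤ A * Real.exp μ * (t ^ (-(k / 2)) * Real.exp (-δ * t)) :=
        mul_le_mul_of_nonneg_left (hS t htS) (by positivity)
      _ = _ := by ring
end

section
/- Let k > 1 and set q = (k+3)/(k-1). There exists a constant C > 0, depending only on k, such that for every continuously differentiable function V : [0,∞) → ℝ with compact support one has ∫₀^∞ t^k |V(t)|^{q+1} dt ≤ C · (∫₀^∞ t^k V'(t)² dt)^{(q+1)/2}. -/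
open MeasureTheory Filter Set Topology

/-- A power weight `t ^ r` with `r > -1` times a compactly supported continuous function is
integrable on the half-line. -/
lemma integrableOn_Ioi_rpow_mul_of_hasCompactSupport {r : ℝ} (hr : -1 < r) {g : ℝ → ℝ}
    (hg : Continuous g) (hs : HasCompactSupport g) :
    IntegrableOn (fun t : ℝ => t ^ r * g t) (Ioi 0) := by
  obtain ⟨R, hR⟩ := hs.isCompact.isBounded.subset_closedBall (0 : ℝ)
  have hIoc : IntegrableOn (fun t : ℝ => t ^ r * g t) (Ioc 0 (max R 0)) := by
    rw [← intervalIntegrable_iff_integrableOn_Ioc_of_le (le_max_right R 0)]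
    exact (intervalIntegral.intervalIntegrable_rpow' hr).mul_continuousOn hg.continuousOn
  refine hIoc.of_forall_sdiff_eq_zero measurableSet_Ioi fun t ht => ?_
  have hgt : g t = 0 := by
    by_contra hne
    have hmem := hR (subset_tsupport g hne)
    rw [Metric.mem_closedBall, dist_zero_right, Real.norm_eq_abs] at hmem
    exact ht.2 ⟨ht.1, (le_abs_self t).trans (hmem.trans (le_max_left R 0))⟩
  simp [hgt]

/-- The weighted energy integrand is integrable. -/
lemma integrableOn_Ioi_rpow_mul_deriv_sq {k : ℝ} (hk : 1 < k) {V : ℝ → ℝ}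
    (hV : ContDiff ℝ 1 V) (hs : HasCompactSupport V) :
    IntegrableOn (fun t : ℝ => t ^ k * (deriv V t) ^ 2) (Ioi 0) :=
  integrableOn_Ioi_rpow_mul_of_hasCompactSupport (by linarith)
    ((hV.continuous_deriv le_rfl).pow 2)
    (hs.deriv.comp_left (g := fun x : ℝ => x ^ 2) (by simp))

/-- A compactly supported function on the line vanishes at infinity. -/
lemma HasCompactSupport.eventuallyEq_zero_atTop {V : ℝ → ℝ} (hs : HasCompactSupport V) :
    V =ᶠ[atTop] 0 :=
  (hasCompactSupport_iff_eventuallyEq.1 hs).filter_mono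
    (atTop_le_cocompact.trans cocompact_le_coclosedCompact)

/-- Weighted Hardy inequality on the half-line. -/
lemma weighted_hardy {k : ℝ} (hk : 1 < k) {V : ℝ → ℝ}
    (hV : ContDiff ℝ 1 V) (hs : HasCompactSupport V) :
    (∫ t in Ioi (0:ℝ), t ^ (k - 2) * V t ^ 2) ≤
      4 / (k - 1) ^ 2 * ∫ t in Ioi (0:ℝ), t ^ k * (deriv V t) ^ 2 := by
  have hE := integrableOn_Ioi_rpow_mul_deriv_sq hk hV hs
  have hH : IntegrableOn (fun t : ℝ => t ^ (k - 2) * V t ^ 2) (Ioi 0) :=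
    integrableOn_Ioi_rpow_mul_of_hasCompactSupport (by linarith) (hV.continuous.pow 2)
      (hs.comp_left (g := fun x : ℝ => x ^ 2) (by simp))
  have hM : IntegrableOn (fun t : ℝ => t ^ (k - 1) * (V t * deriv V t)) (Ioi 0) :=
    integrableOn_Ioi_rpow_mul_of_hasCompactSupport (by linarith)
      (hV.continuous.mul (hV.continuous_deriv le_rfl)) hs.mul_right
  have hparts : ∫ t in Ioi (0:ℝ), ((k - 1) * (t ^ (k - 2) * V t ^ 2)
      + 2 * (t ^ (k - 1) * (V t * deriv V t))) = 0 := by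
    have hftc := integral_Ioi_of_hasDerivAt_of_tendsto (a := 0) (m := 0)
      (f := fun t : ℝ => t ^ (k - 1) * V t ^ 2)
      (f' := fun t : ℝ => (k - 1) * (t ^ (k - 2) * V t ^ 2)
        + 2 * (t ^ (k - 1) * (V t * deriv V t)))
      (((Real.continuous_rpow_const (by linarith)).mul
        (hV.continuous.pow 2)).continuousWithinAt)
      (fun t ht => by
        have h1 := Real.hasDerivAt_rpow_const (x := t) (p := k - 1) (Or.inl (ne_of_gt ht))
        have h2 := ((hV.differentiable one_ne_zero) t).hasDerivAt.pow 2
        have h3 := h1.mul h2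
        rw [show k - 1 - 1 = k - 2 by ring] at h3
        refine h3.congr_deriv ?_
        simp only [Pi.pow_apply, Nat.cast_ofNat]
        ring)
      ((hH.const_mul _).fun_add (hM.const_mul _))
      (tendsto_const_nhds.congr' (by
        filter_upwards [hs.eventuallyEq_zero_atTop] with t ht
        simp [ht]))
    simpa [Real.zero_rpow (by linarith : k - 1 ≠ 0)] using hftc
  rw [integral_add (hH.const_mul _) (hM.const_mul _), integral_const_mul,
    integral_const_mul] at hparts
  have hsq : 0 ≤ ∫ t in Ioi (0:ℝ), (t ^ k * (deriv V t) ^ 2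
      + ((k - 1) * (t ^ (k - 1) * (V t * deriv V t))
        + (k - 1) ^ 2 / 4 * (t ^ (k - 2) * V t ^ 2))) := by
    refine setIntegral_nonneg measurableSet_Ioi fun t (ht : 0 < t) => ?_
    have h1 : t ^ (k - 1) = t ^ (k - 2) * t := by
      rw [← Real.rpow_add_one ht.ne']; ring_nf
    have h2 : t ^ k = t ^ (k - 2) * t * t := by
      rw [← h1, ← Real.rpow_add_one ht.ne']; ring_nf
    rw [h1, h2]
    calc 0 ≤ t ^ (k - 2) * (t * deriv V t + (k - 1) / 2 * V t) ^ 2 := by positivity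
      _ = _ := by ring
  rw [integral_add hE ((hM.const_mul _).fun_add (hH.const_mul _)),
    integral_add (hM.const_mul _) (hH.const_mul _), integral_const_mul,
    integral_const_mul] at hsq
  have hk' : 0 < (k - 1) ^ 2 := pow_pos (by linarith) 2
  rw [div_mul_eq_mul_div, le_div_iff₀ hk']
  linear_combination 4 * hsq + 2 * (k - 1) * hparts

/-- Pointwise decay of a function of finite weighted energy. -/
lemma sq_le_weighted_energy_mul_rpow {k : ℝ} (hk : 1 < k) {V : ℝ → ℝ}
    (hV : ContDiff ℝ 1 V) (hs : HasCompactSupport V) {t : ℝ} (ht : 0 < t) :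
    V t ^ 2 ≤ (∫ s in Ioi (0:ℝ), s ^ k * (deriv V s) ^ 2) * (t ^ (1 - k) / (k - 1)) := by
  have hE0 := integrableOn_Ioi_rpow_mul_deriv_sq hk hV hs
  have hE := hE0.mono_set (Ioi_subset_Ioi ht.le)
  have hD : IntegrableOn (deriv V) (Ioi t) :=
    ((hV.continuous_deriv le_rfl).integrable_of_hasCompactSupport hs.deriv).integrableOn
  have hW : IntegrableOn (fun s : ℝ => s ^ (-k)) (Ioi t) :=
    integrableOn_Ioi_rpow_of_lt (by linarith) ht
  have hDint : ∫ s in Ioi t, deriv V s = 0 - V t :=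
    integral_Ioi_of_hasDerivAt_of_tendsto hV.continuous.continuousWithinAt
      (fun s _ => ((hV.differentiable one_ne_zero) s).hasDerivAt) hD
      (tendsto_const_nhds.congr' hs.eventuallyEq_zero_atTop.symm)
  have hWint : ∫ s in Ioi t, s ^ (-k) = t ^ (1 - k) / (k - 1) := by
    rw [integral_Ioi_rpow_of_lt (by linarith) ht, show -k + 1 = -(k - 1) by ring,
      show 1 - k = -(k - 1) by ring, neg_div_neg_eq]
  have hmono : ∫ s in Ioi t, s ^ k * (deriv V s) ^ 2 ≤
      ∫ s in Ioi (0:ℝ), s ^ k * (deriv V s) ^ 2 := by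
    refine setIntegral_mono_set hE0 ?_ (Ioi_subset_Ioi ht.le).eventuallyLE
    filter_upwards [ae_restrict_mem measurableSet_Ioi] with s hs
    have : (0:ℝ) < s := hs
    simp only [Pi.zero_apply]
    positivity
  set B := t ^ (1 - k) / (k - 1) with hB
  have hBpos : 0 < B := div_pos (Real.rpow_pos_of_pos ht _) (by linarith)
  have hsq : 0 ≤ ∫ s in Ioi t, (s ^ k * (deriv V s) ^ 2
      + (2 * (V t / B) * deriv V s + (V t / B) ^ 2 * s ^ (-k))) := by
    refine setIntegral_nonneg measurableSet_Ioi fun s (hs : t < s) => ?_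
    have hs0 : 0 < s := ht.trans hs
    have hpos : 0 < s ^ k := Real.rpow_pos_of_pos hs0 _
    rw [Real.rpow_neg hs0.le]
    calc 0 ≤ (s ^ k)⁻¹ * (s ^ k * deriv V s + V t / B) ^ 2 := by positivity
      _ = _ := by field_simp; ring
  rw [integral_add hE ((hD.const_mul _).fun_add (hW.const_mul _)),
    integral_add (hD.const_mul _) (hW.const_mul _), integral_const_mul,
    integral_const_mul, hDint, hWint] at hsq
  rw [← div_le_iff₀ hBpos]
  have hid : 2 * (V t / B) * (0 - V t) + (V t / B) ^ 2 * B = -(V t ^ 2 / B) := by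
    field_simp; ring
  linarith

theorem stmt12 (k : ℝ) (hk : 1 < k) :
    ∃ C > (0:ℝ), ∀ V : ℝ → ℝ, ContDiff ℝ 1 V → HasCompactSupport V →
      (∫ t in Ioi (0:ℝ), t ^ k * |V t| ^ ((k + 3) / (k - 1) + 1)) ≤
        C * (∫ t in Ioi (0:ℝ), t ^ k * (deriv V t) ^ 2) ^ (((k + 3) / (k - 1) + 1) / 2) := by
  have hk1 : 0 < k - 1 := by linarith
  obtain ⟨e, he⟩ : ∃ e, e = 2 / (k - 1) := ⟨_, rfl⟩
  have hepos : 0 < e := by rw [he]; positivity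
  have hp : (k + 3) / (k - 1) + 1 = 2 * (e + 1) := by rw [he]; field_simp; ring
  refine ⟨((k - 1) ^ e)⁻¹ * (4 / (k - 1) ^ 2), by positivity, fun V hV hs => ?_⟩
  rw [hp, mul_div_cancel_left₀ _ (two_ne_zero' ℝ)]
  have hH : IntegrableOn (fun t : ℝ => t ^ (k - 2) * V t ^ 2) (Ioi 0) :=
    integrableOn_Ioi_rpow_mul_of_hasCompactSupport (by linarith) (hV.continuous.pow 2)
      (hs.comp_left (g := fun x : ℝ => x ^ 2) (by simp))
  have hE0 : 0 ≤ ∫ t in Ioi (0:ℝ), t ^ k * (deriv V t) ^ 2 :=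
    setIntegral_nonneg measurableSet_Ioi fun t (ht : 0 < t) => by positivity
  have hpt := fun (t : ℝ) (ht : 0 < t) => sq_le_weighted_energy_mul_rpow hk hV hs ht
  have hhardy := weighted_hardy hk hV hs
  set E := ∫ t in Ioi (0:ℝ), t ^ k * (deriv V t) ^ 2
  calc ∫ t in Ioi (0:ℝ), t ^ k * |V t| ^ (2 * (e + 1))
      ≤ ∫ t in Ioi (0:ℝ), E ^ e * ((k - 1) ^ e)⁻¹ * (t ^ (k - 2) * V t ^ 2) := by
        refine integral_mono_of_nonneg ?_ (hH.const_mul _) ?_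
        · filter_upwards [ae_restrict_mem measurableSet_Ioi] with t ht
          have : (0:ℝ) < t := ht
          simp only [Pi.zero_apply]
          positivity
        filter_upwards [ae_restrict_mem measurableSet_Ioi] with t ht
        have ht0 : (0:ℝ) < t := ht
        have hsplit : |V t| ^ (2 * (e + 1)) = (V t ^ 2) ^ e * V t ^ 2 := by
          rw [Real.rpow_mul (abs_nonneg _), Real.rpow_two, sq_abs,
            Real.rpow_add_one' (sq_nonneg _) (by positivity)]
        have hexp : (t ^ (1 - k)) ^ e = t ^ (-2 : ℝ) := by
          rw [← Real.rpow_mul ht0.le, he]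
          congr 1
          field_simp
          ring
        have hbound : (V t ^ 2) ^ e ≤ E ^ e * ((k - 1) ^ e)⁻¹ * t ^ (-2 : ℝ) := by
          refine (Real.rpow_le_rpow (sq_nonneg _) (hpt t ht0) hepos.le).trans_eq ?_
          rw [Real.mul_rpow hE0 (by positivity), Real.div_rpow (by positivity) hk1.le, hexp]
          ring
        have hk2 : t ^ (k - 2) = t ^ k * t ^ (-2 : ℝ) := by
          rw [← Real.rpow_add ht0, sub_eq_add_neg]
        calc t ^ k * |V t| ^ (2 * (e + 1)) = t ^ k * ((V t ^ 2) ^ e * V t ^ 2) := by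
              rw [hsplit]
          _ ≤ t ^ k * (E ^ e * ((k - 1) ^ e)⁻¹ * t ^ (-2 : ℝ) * V t ^ 2) := by gcongr
          _ = E ^ e * ((k - 1) ^ e)⁻¹ * (t ^ (k - 2) * V t ^ 2) := by rw [hk2]; ring
    _ = E ^ e * ((k - 1) ^ e)⁻¹ * ∫ t in Ioi (0:ℝ), t ^ (k - 2) * V t ^ 2 :=
        integral_const_mul _ _
    _ ≤ E ^ e * ((k - 1) ^ e)⁻¹ * (4 / (k - 1) ^ 2 * E) := by gcongr
    _ = ((k - 1) ^ e)⁻¹ * (4 / (k - 1) ^ 2) * E ^ (e + 1) := by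
        rw [Real.rpow_add_one' hE0 (by positivity)]; ring
end

section
/- Let N ≥ 3, α > 0 and m > 0. Let h : [0,∞) → [0,∞) be continuous and nondecreasing with h(0) = 0 and lim_{s→0⁺} h(s)/s = 0. Suppose ζ : ℝ^N → ℝ is a positive radial function, continuous on ℝ^N and twice continuously differentiable on ℝ^N∖{0}, satisfying -Δζ(x) + m|x|^α ζ(x) = |x|^α h(e^{-|x|}) for all x ≠ 0 and ζ(x) → 0 as |x| → ∞. Then lim_{|x|→∞} e^{|x|} ζ(x) = 0; that is, ζ vanishes at infinity faster than e^{-|x|}. -/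
open MeasureTheory Filter Set Topology

/-- The Euclidean Laplacian: sum of second partial derivatives. -/
noncomputable def lap {N : ℕ} (u : EuclideanSpace ℝ (Fin N) → ℝ)
    (x : EuclideanSpace ℝ (Fin N)) : ℝ :=
  ∑ i : Fin N, fderiv ℝ (fun y => fderiv ℝ u y (EuclideanSpace.single i 1)) x
    (EuclideanSpace.single i 1)

/-- Necessary second order condition at a local maximum on the line. -/
theorem IsLocalMax.second_deriv_nonpos {f f' : ℝ → ℝ} {a c : ℝ} (hmax : IsLocalMax f a)
    (hf : ∀ᶠ t in 𝓝 a, HasDerivAt f (f' t) t) (hf' : HasDerivAt f' c a) : c ≤ 0 := by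
  by_contra! hc
  have hd : deriv f =ᶠ[𝓝 a] f' := hf.mono fun t ht => ht.deriv
  have hdd : deriv (deriv f) a = c := (hf'.congr_of_eventuallyEq hd).deriv
  have hmin : IsLocalMin f a := isLocalMin_of_deriv_deriv_pos (by rwa [hdd]) hmax.deriv_eq_zero
    hf.self_of_nhds.continuousAt
  have hconst : f =ᶠ[𝓝 a] fun _ => f a := by
    filter_upwards [hmax, hmin] with t h1 h2 using le_antisymm h1 h2
  have h0 : deriv (deriv f) a = 0 := by
    rw [hconst.deriv.deriv_eq]
    simp
  linarith

/-- At a local maximum of `ζ - A exp(-2‖·‖) - δ exp(-‖·‖)` away from the origin, the Laplacian of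
`ζ` is bounded by the second radial derivative of the exponential part. -/
theorem lap_le_of_isLocalMax {N : ℕ} {ζ : EuclideanSpace ℝ (Fin N) → ℝ}
    {x : EuclideanSpace ℝ (Fin N)} {A δ : ℝ} (hA : 0 ≤ A) (hδ : 0 ≤ δ) (hx : x ≠ 0)
    (hζ : ContDiffAt ℝ 2 ζ x)
    (hmax : IsLocalMax (fun y => ζ y - A * Real.exp (-2 * ‖y‖) - δ * Real.exp (-‖y‖)) x) :
    lap ζ x ≤ 4 * A * Real.exp (-2 * ‖x‖) + δ * Real.exp (-‖x‖) := by
  have hr : 0 < ‖x‖ := norm_pos_iff.2 hx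
  have key : ∀ i : Fin N, fderiv ℝ (fun y => fderiv ℝ ζ y (EuclideanSpace.single i 1)) x
      (EuclideanSpace.single i 1) ≤
      (x i / ‖x‖) ^ 2 * (4 * A * Real.exp (-2 * ‖x‖) + δ * Real.exp (-‖x‖)) := by
    intro i
    set e : EuclideanSpace ℝ (Fin N) := EuclideanSpace.single i 1 with he
    set n : ℝ := x i / ‖x‖ with hn
    have hline : ∀ t : ℝ, HasDerivAt (fun s : ℝ => x + s • e) e t := fun t => by
      simpa using ((hasDerivAt_id t).smul_const e).const_add x
    have hline0 : Tendsto (fun s : ℝ => x + s • e) (𝓝 0) (𝓝 x) := by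
      simpa using (hline 0).continuousAt.tendsto
    have hlin : ∀ t : ℝ, ‖x‖ + t * n ≤ ‖x + t • e‖ := by
      intro t
      have h1 := real_inner_le_norm x (x + t • e)
      have h2 : inner ℝ x (x + t • e) = ‖x‖ ^ 2 + t * x i := by
        rw [inner_add_right, inner_smul_right, real_inner_self_eq_norm_sq, he,
          EuclideanSpace.inner_single_right]
        simp
      rw [h2] at h1
      have h3 : ‖x‖ * (‖x‖ + t * n) = ‖x‖ ^ 2 + t * x i := by
        rw [hn]; field_simp
      exact le_of_mul_le_mul_left (h3.trans_le h1) hr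
    have hmax' : IsLocalMax (fun t : ℝ => ζ (x + t • e) - A * Real.exp (-2 * (‖x‖ + t * n))
        - δ * Real.exp (-(‖x‖ + t * n))) 0 := by
      filter_upwards [hline0.eventually hmax] with t ht
      have h1 : A * Real.exp (-2 * ‖x + t • e‖) ≤ A * Real.exp (-2 * (‖x‖ + t * n)) := by
        gcongr A * Real.exp ?_
        linarith [hlin t]
      have h2 : δ * Real.exp (-‖x + t • e‖) ≤ δ * Real.exp (-(‖x‖ + t * n)) := by
        gcongr
        exact hlin t
      simp only [zero_smul, add_zero, zero_mul]
      linarith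
    have hexp : ∀ k t : ℝ, HasDerivAt (fun t : ℝ => Real.exp (k * (‖x‖ + t * n)))
        (k * n * Real.exp (k * (‖x‖ + t * n))) t := by
      intro k t
      have := ((((hasDerivAt_id t).mul_const n).const_add ‖x‖).const_mul k).exp
      simp only [id] at this
      convert this using 1
      ring
    have hd1 : ∀ᶠ t in 𝓝 (0 : ℝ), HasDerivAt (fun t : ℝ => ζ (x + t • e)
        - A * Real.exp (-2 * (‖x‖ + t * n)) - δ * Real.exp (-(‖x‖ + t * n)))
        (fderiv ℝ ζ (x + t • e) e - A * (-2 * n * Real.exp (-2 * (‖x‖ + t * n)))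
        - δ * (-1 * n * Real.exp (-1 * (‖x‖ + t * n)))) t := by
      have hdiff : ∀ᶠ y in 𝓝 x, DifferentiableAt ℝ ζ y :=
        (hζ.eventually (by simp)).mono fun y hy => hy.differentiableAt (by simp)
      filter_upwards [hline0.eventually hdiff] with t ht
      have h1 := ht.hasFDerivAt.comp_hasDerivAt t (hline t)
      have h2 := (h1.sub ((hexp (-2) t).const_mul A)).sub ((hexp (-1) t).const_mul δ)
      exact h2.congr_of_eventuallyEq (Eventually.of_forall fun s => by simp)
    have hd2 : DifferentiableAt ℝ (fun y => fderiv ℝ ζ y e) x :=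
      ((hζ.fderiv_right (m := 1) (by norm_num)).differentiableAt (by simp)).clm_apply
        (differentiableAt_const e)
    have hd3 := (((hd2.hasFDerivAt.comp_hasDerivAt_of_eq (0 : ℝ) (hline 0) (by simp)).sub
      (((hexp (-2) 0).const_mul (-2 * n)).const_mul A)).sub
      (((hexp (-1) 0).const_mul (-1 * n)).const_mul δ))
    have := hmax'.second_deriv_nonpos hd1 hd3
    simp only [zero_mul, add_zero, neg_mul, one_mul] at this ⊢
    linarith
  have hsum : ∑ i : Fin N, (x i / ‖x‖) ^ 2 = 1 := by
    simp_rw [div_pow]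
    rw [← Finset.sum_div, ← EuclideanSpace.real_norm_sq_eq, div_self (by positivity)]
  calc lap ζ x ≤ ∑ i : Fin N,
        (x i / ‖x‖) ^ 2 * (4 * A * Real.exp (-2 * ‖x‖) + δ * Real.exp (-‖x‖)) :=
        Finset.sum_le_sum fun i _ => key i
    _ = _ := by rw [← Finset.sum_mul, hsum, one_mul]

/-- Comparison principle outside a ball for subsolutions of `-Δζ + V ζ ≤ f`, with barrier
`A exp(-2‖·‖) + δ exp(-‖·‖)`. -/
theorem le_exp_barrier {N : ℕ} {ζ : EuclideanSpace ℝ (Fin N) → ℝ} {A δ R : ℝ}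
    (hA : 0 ≤ A) (hδ : 0 ≤ δ) (hR : 0 < R) (hc : Continuous ζ)
    (hc2 : ContDiffOn ℝ 2 ζ {x | x ≠ 0})
    (hbdry : ∀ x, ‖x‖ = R → ζ x ≤ A * Real.exp (-2 * ‖x‖) + δ * Real.exp (-‖x‖))
    (hsub : ∀ x, R < ‖x‖ → A * Real.exp (-2 * ‖x‖) + δ * Real.exp (-‖x‖) < ζ x →
      4 * A * Real.exp (-2 * ‖x‖) + δ * Real.exp (-‖x‖) < lap ζ x)
    (hdec : Tendsto ζ (comap (fun x => ‖x‖) atTop) (𝓝 0))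
    (x : EuclideanSpace ℝ (Fin N)) (hx : R ≤ ‖x‖) :
    ζ x ≤ A * Real.exp (-2 * ‖x‖) + δ * Real.exp (-‖x‖) := by
  by_contra! hlt
  set v : EuclideanSpace ℝ (Fin N) → ℝ :=
    fun y => ζ y - A * Real.exp (-2 * ‖y‖) - δ * Real.exp (-‖y‖) with hv
  have hvc : Continuous v := by fun_prop
  have hvx : 0 < v x := by simp only [hv]; linarith
  have hev : ∀ᶠ y in cocompact (EuclideanSpace ℝ (Fin N)), v y ≤ v x := by
    rw [← Metric.cobounded_eq_cocompact, ← comap_norm_atTop]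
    filter_upwards [hdec.eventually (eventually_lt_nhds hvx)] with y hy
    have h1 : 0 ≤ A * Real.exp (-2 * ‖y‖) := by positivity
    have h2 : 0 ≤ δ * Real.exp (-‖y‖) := by positivity
    simp only [hv] at hy ⊢
    linarith
  obtain ⟨z, hzR, hz⟩ := hvc.continuousOn.exists_isMaxOn' (s := {y | R ≤ ‖y‖})
    (isClosed_le continuous_const continuous_norm) hx (hev.filter_mono inf_le_left)
  have hvz : 0 < v z := hvx.trans_le (hz hx)
  have hζz : A * Real.exp (-2 * ‖z‖) + δ * Real.exp (-‖z‖) < ζ z := by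
    simp only [hv] at hvz; linarith
  have hzR' : R < ‖z‖ := lt_of_le_of_ne hzR fun hEq => (hbdry z hEq.symm).not_gt hζz
  have hz0 : z ≠ 0 := norm_pos_iff.1 (hR.trans hzR')
  have hmax : IsLocalMax v z := by
    filter_upwards [continuous_norm.continuousAt.eventually (lt_mem_nhds hzR')] with y hy
      using hz hy.le
  exact (lap_le_of_isLocalMax hA hδ hz0
    (hc2.contDiffAt (isOpen_ne.mem_nhds hz0)) hmax).not_gt (hsub z hzR' hζz)

theorem stmt13 (N : ℕ) (hN : 3 ≤ N) (α m : ℝ) (hα : 0 < α) (hm : 0 < m)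
    (h : ℝ → ℝ) (hcont : ContinuousOn h (Ici 0)) (hmono : MonotoneOn h (Ici 0))
    (hnonneg : ∀ s ∈ Ici (0:ℝ), 0 ≤ h s) (h0 : h 0 = 0)
    (hlim : Tendsto (fun s => h s / s) (𝓝[>] 0) (𝓝 0))
    (ζ : EuclideanSpace ℝ (Fin N) → ℝ)
    (hrad : ∀ x y : EuclideanSpace ℝ (Fin N), ‖x‖ = ‖y‖ → ζ x = ζ y)
    (hpos : ∀ x, 0 < ζ x) (hc : Continuous ζ)
    (hc2 : ContDiffOn ℝ 2 ζ {x | x ≠ 0})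
    (heq : ∀ x : EuclideanSpace ℝ (Fin N), x ≠ 0 →
      -(lap ζ x) + m * ‖x‖ ^ α * ζ x = ‖x‖ ^ α * h (Real.exp (-‖x‖)))
    (hdec : Tendsto ζ (comap (fun x => ‖x‖) atTop) (𝓝 0)) :
    Tendsto (fun x => Real.exp ‖x‖ * ζ x) (comap (fun x => ‖x‖) atTop) (𝓝 0) := by
  have : Nonempty (Fin N) := ⟨⟨0, by omega⟩⟩
  rw [Metric.tendsto_nhds]
  intro η hη
  obtain ⟨δ, hδ, hδη⟩ : ∃ δ, 0 < δ ∧ δ < η := exists_between hη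
  have hexp0 : Tendsto (fun r : ℝ => Real.exp (-r)) atTop (𝓝[>] 0) :=
    tendsto_nhdsWithin_iff.2 ⟨Real.tendsto_exp_neg_atTop_nhds_zero,
      Eventually.of_forall fun r => Real.exp_pos _⟩
  have ev1 : ∀ᶠ r : ℝ in atTop, h (Real.exp (-r)) / Real.exp (-r) < m * δ / 2 :=
    (hlim.comp hexp0).eventually (gt_mem_nhds (by positivity))
  have ev2 : ∀ᶠ r : ℝ in atTop, 4 / m ≤ r ^ α :=
    (tendsto_rpow_atTop hα).eventually_ge_atTop _
  obtain ⟨R, hR⟩ := eventually_atTop.1 ((ev1.and ev2).and (eventually_gt_atTop 0))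
  have hR0 : 0 < R := (hR R le_rfl).2
  obtain ⟨y, hy⟩ : ∃ y : EuclideanSpace ℝ (Fin N), ‖y‖ = R := by
    refine ⟨EuclideanSpace.single (Classical.arbitrary _) R, ?_⟩
    simp [abs_of_pos hR0]
  set A := ζ y * Real.exp (2 * R) with hA
  have hApos : 0 < A := mul_pos (hpos y) (Real.exp_pos _)
  have hbound := le_exp_barrier hApos.le hδ.le hR0 hc hc2
    (fun x hx => by
      have h1 : A * Real.exp (-2 * ‖x‖) = ζ x := by
        rw [hA, hx, mul_assoc, ← Real.exp_add, hrad x y (hx.trans hy.symm)]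
        simp
      have h2 : 0 ≤ δ * Real.exp (-‖x‖) := by positivity
      linarith)
    (fun x hx hlt => by
      obtain ⟨⟨h1, h2⟩, h3⟩ := hR ‖x‖ hx.le
      rw [div_lt_iff₀ (Real.exp_pos _)] at h1
      rw [div_le_iff₀ hm] at h2
      have h4 := heq x (norm_pos_iff.1 h3)
      have hp : 0 < ‖x‖ ^ α := Real.rpow_pos_of_pos h3 _
      have hE1 : 0 < A * Real.exp (-2 * ‖x‖) := by positivity
      have hE2 : 0 < δ * Real.exp (-‖x‖) := by positivity
      have h5 := mul_lt_mul_of_pos_left h1 hp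
      have h6 := mul_lt_mul_of_pos_left hlt (mul_pos hp hm)
      have h7 := mul_le_mul_of_nonneg_right h2 hE1.le
      have h8 := mul_le_mul_of_nonneg_right h2 hE2.le
      linarith)
    hdec
  have hlimA : Tendsto (fun r : ℝ => A * Real.exp (-r) + δ) atTop (𝓝 δ) := by
    simpa using (Real.tendsto_exp_neg_atTop_nhds_zero.const_mul A).add_const δ
  filter_upwards [tendsto_comap.eventually (hlimA.eventually (gt_mem_nhds hδη)),
    tendsto_comap.eventually (eventually_ge_atTop R)] with x hx1 hx2
  rw [Real.dist_0_eq_abs, abs_of_pos (mul_pos (Real.exp_pos _) (hpos x))]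
  refine lt_of_le_of_lt ?_ hx1
  calc Real.exp ‖x‖ * ζ x
      ≤ Real.exp ‖x‖ * (A * Real.exp (-2 * ‖x‖) + δ * Real.exp (-‖x‖)) := by
        gcongr; exact hbound x hx2
    _ = A * Real.exp (-‖x‖) + δ := by
        have h1 : Real.exp ‖x‖ * Real.exp (-2 * ‖x‖) = Real.exp (-‖x‖) := by
          rw [← Real.exp_add]; ring_nf
        have h2 : Real.exp ‖x‖ * Real.exp (-‖x‖) = 1 := by
          rw [← Real.exp_add]; simp
        linear_combination A * h1 + δ * h2
end
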